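/- Assume d ≥ 3, Ω is irreducible, and the torsion-free group Γ divides Ω. If F is a flat of Ω whose stabilizer Stab_Γ(F) = {γ ∈ Γ : γ̄(F) = F} is an infinite group, then F is isolated: no sequence of flats of Ω, all distinct from F, converges to F. -/

import Mathlib

open Set Filter Metric

noncomputable section

/-- `ℝ^d`. -/
abbrev Euc (d : ℕ) := EuclideanSpace ℝ (Fin d)

/-- A flat of `Ω` with prescribed vertices `v`. -/
def IsFlatWith {d : ℕ} (Ω : Set (Euc d)) (v : Fin d → Euc d) : Prop :=
  AffineIndependent ℝ v ∧
  (∀ j, v j ∈ closure Ω \ Ω) ∧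
  intrinsicInterior ℝ (convexHull ℝ (Set.range v)) ⊆ Ω ∧
  convexHull ℝ (Set.range v) \ intrinsicInterior ℝ (convexHull ℝ (Set.range v)) ⊆ closure Ω \ Ω

/-- A (codimension-one, properly embedded) flat of `Ω`. -/
def IsFlat {d : ℕ} (Ω : Set (Euc d)) (F : Set (Euc d)) : Prop :=
  ∃ v : Fin d → Euc d, IsFlatWith Ω v ∧ F = intrinsicInterior ℝ (convexHull ℝ (Set.range v))

/-- The cone over a subset of `ℝ^d`, inside `ℝ^d × ℝ ≅ ℝ^{d+1}`. -/
def coneOver {d : ℕ} (S : Set (Euc d)) : Set (Euc d × ℝ) :=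
  {p | ∃ t : ℝ, 0 < t ∧ ∃ x ∈ S, p = t • (x, (1 : ℝ))}

/-- Irreducibility of a properly convex domain: its cone admits no direct-sum
decomposition into convex cones. -/
def IsIrreducibleDomain {d : ℕ} (Ω : Set (Euc d)) : Prop :=
  ¬ ∃ (V₁ V₂ : Submodule ℝ (Euc d × ℝ)) (C₁ C₂ : Set (Euc d × ℝ)),
      V₁ ≠ ⊥ ∧ V₂ ≠ ⊥ ∧ V₁ ≠ ⊤ ∧ V₂ ≠ ⊤ ∧ IsCompl V₁ V₂ ∧
      C₁ ⊆ (V₁ : Set (Euc d × ℝ)) ∧ C₂ ⊆ (V₂ : Set (Euc d × ℝ)) ∧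
      Convex ℝ C₁ ∧ Convex ℝ C₂ ∧
      (∀ t : ℝ, 0 < t → ∀ c ∈ C₁, t • c ∈ C₁) ∧
      (∀ t : ℝ, 0 < t → ∀ c ∈ C₂, t • c ∈ C₂) ∧
      coneOver Ω = {p | ∃ c₁ ∈ C₁, ∃ c₂ ∈ C₂, p = c₁ + c₂}

/-- The homeomorphism of `Ω` induced by a linear automorphism of `ℝ^{d+1}`
preserving the cone over `Ω`. -/
def projAct {d : ℕ} (g : (Euc d × ℝ) ≃ₗ[ℝ] (Euc d × ℝ)) (x : Euc d) : Euc d :=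
  ((g (x, 1)).2)⁻¹ • (g (x, 1)).1

/-- `Γ` divides `Ω`: every element preserves the cone over `Ω`; the induced action on `Ω`
is free and properly discontinuous, and admits a compact set whose translates cover `Ω`. -/
def Divides {d : ℕ} (Ω : Set (Euc d))
    (Γ : Subgroup ((Euc d × ℝ) ≃ₗ[ℝ] (Euc d × ℝ))) : Prop :=
  (∀ γ ∈ Γ, (γ : (Euc d × ℝ) ≃ₗ[ℝ] (Euc d × ℝ)) '' coneOver Ω = coneOver Ω) ∧
  (∀ γ ∈ Γ, γ ≠ 1 → ∀ x ∈ Ω, projAct γ x ≠ x) ∧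
  (∀ K : Set (Euc d), K ⊆ Ω → IsCompact K →
    {γ : (Euc d × ℝ) ≃ₗ[ℝ] (Euc d × ℝ) | γ ∈ Γ ∧ (projAct γ '' K ∩ K).Nonempty}.Finite) ∧
  (∃ K : Set (Euc d), K ⊆ Ω ∧ IsCompact K ∧ (⋃ γ ∈ Γ, projAct γ '' K) = Ω)

/-- `Γ` is torsion-free. -/
def TorsionFreeSub {d : ℕ} (Γ : Subgroup ((Euc d × ℝ) ≃ₗ[ℝ] (Euc d × ℝ))) : Prop :=
  ∀ γ ∈ Γ, ∀ n : ℕ, n ≠ 0 → γ ^ n = 1 → γ = 1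

/-- Convergence of a sequence of flats: Hausdorff convergence of their closures. -/
def FlatsConverge {d : ℕ} (Fs : ℕ → Set (Euc d)) (F : Set (Euc d)) : Prop :=
  Tendsto (fun i => hausdorffDist (closure (Fs i)) (closure F)) atTop (nhds 0)

/-- A flat is isolated if no sequence of flats, all distinct from it, converges to it. -/
def IsIsolatedFlat {d : ℕ} (Ω F : Set (Euc d)) : Prop :=
  ¬ ∃ Fs : ℕ → Set (Euc d), (∀ i, IsFlat Ω (Fs i)) ∧ (∀ i, Fs i ≠ F) ∧ FlatsConverge Fs F

/-- The union of all flats of `Ω`. -/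
def flatsUnion {d : ℕ} (Ω : Set (Euc d)) : Set (Euc d) := ⋃₀ {F | IsFlat Ω F}

/-- A boundary flat: a flat contained in the closure of a connected component of the
complement of the union of all flats. -/
def IsBoundaryFlat {d : ℕ} (Ω F : Set (Euc d)) : Prop :=
  IsFlat Ω F ∧ ∃ x ∈ Ω \ flatsUnion Ω,
    F ⊆ closure (connectedComponentIn (Ω \ flatsUnion Ω) x)

/-- Nonempty open convex cones whose closure contains no line. -/
structure SharpCone {V : Type*} [NormedAddCommGroup V] [NormedSpace ℝ V] (C : Set V) : Prop where
  isOpen : IsOpen C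
  convex : Convex ℝ C
  smul_mem : ∀ t : ℝ, 0 < t → ∀ z ∈ C, t • z ∈ C
  nonempty : C.Nonempty
  eq_zero : ∀ z ∈ closure C, -z ∈ closure C → z = 0

/-- The linear automorphisms of the cone move every point into a fixed compact set. -/
def CocompactCone {V : Type*} [NormedAddCommGroup V] [NormedSpace ℝ V] (C : Set V) : Prop :=
  ∃ K ⊆ C, IsCompact K ∧ ∀ z ∈ C, ∃ A : V ≃ₗ[ℝ] V, A '' C = C ∧ A z ∈ K

/-- The cone is a nontrivial direct sum of convex cones. -/
def SplitCone {V : Type*} [AddCommGroup V] [Module ℝ V] (C : Set V) : Prop :=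
  ∃ (V₁ V₂ : Submodule ℝ V) (C₁ C₂ : Set V),
      V₁ ≠ ⊥ ∧ V₂ ≠ ⊥ ∧ V₁ ≠ ⊤ ∧ V₂ ≠ ⊤ ∧ IsCompl V₁ V₂ ∧
      C₁ ⊆ (V₁ : Set V) ∧ C₂ ⊆ (V₂ : Set V) ∧
      Convex ℝ C₁ ∧ Convex ℝ C₂ ∧
      (∀ t : ℝ, 0 < t → ∀ c ∈ C₁, t • c ∈ C₁) ∧
      (∀ t : ℝ, 0 < t → ∀ c ∈ C₂, t • c ∈ C₂) ∧
      C = {p | ∃ c₁ ∈ C₁, ∃ c₂ ∈ C₂, p = c₁ + c₂}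

lemma SplitCone.image {V U : Type*} [AddCommGroup V] [Module ℝ V] [AddCommGroup U] [Module ℝ U]
    {C : Set V} (h : SplitCone C) (e : V ≃ₗ[ℝ] U) : SplitCone (e '' C) := by
  obtain ⟨V₁, V₂, C₁, C₂, h1, h2, h3, h4, h5, h6, h7, h8, h9, h10, h11, h12⟩ := h
  let o := Submodule.orderIsoMapComap e
  refine ⟨o V₁, o V₂, e '' C₁, e '' C₂, ?_, ?_, ?_, ?_, ?_, ?_, ?_, ?_, ?_, ?_, ?_, ?_⟩
  · rwa [Ne, _root_.map_eq_bot_iff]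
  · rwa [Ne, _root_.map_eq_bot_iff]
  · rwa [Ne, _root_.map_eq_top_iff]
  · rwa [Ne, _root_.map_eq_top_iff]
  · exact (OrderIso.isCompl_iff o).1 h5
  · rintro _ ⟨x, hx, rfl⟩
    exact Submodule.mem_map_of_mem (h6 hx)
  · rintro _ ⟨x, hx, rfl⟩
    exact Submodule.mem_map_of_mem (h7 hx)
  · exact h8.linear_image e.toLinearMap
  · exact h9.linear_image e.toLinearMap
  · rintro t ht _ ⟨x, hx, rfl⟩
    exact ⟨t • x, h10 t ht x hx, map_smul e t x⟩
  · rintro t ht _ ⟨x, hx, rfl⟩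
    exact ⟨t • x, h11 t ht x hx, map_smul e t x⟩
  · ext y
    constructor
    · rintro ⟨x, hx, rfl⟩
      rw [h12] at hx
      obtain ⟨c₁, hc₁, c₂, hc₂, rfl⟩ := hx
      exact ⟨e c₁, ⟨c₁, hc₁, rfl⟩, e c₂, ⟨c₂, hc₂, rfl⟩, map_add e c₁ c₂⟩
    · rintro ⟨_, ⟨c₁, hc₁, rfl⟩, _, ⟨c₂, hc₂, rfl⟩, rfl⟩
      exact ⟨c₁ + c₂, by rw [h12]; exact ⟨c₁, hc₁, c₂, hc₂, rfl⟩, map_add e c₁ c₂⟩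

section ConeLimits

variable {V : Type*} [NormedAddCommGroup V] [NormedSpace ℝ V]

lemma SharpCone.add_mem {C : Set V} (hC : SharpCone C) {z w : V} (hz : z ∈ C)
    (hw : w ∈ closure C) : z + w ∈ C := by
  have h := hC.convex.openSegment_interior_closure_subset_interior
    (by rwa [hC.isOpen.interior_eq]) hw
    (⟨1 / 2, 1 / 2, by norm_num, by norm_num, by norm_num, rfl⟩ :
      (1 / 2 : ℝ) • z + (1 / 2 : ℝ) • w ∈ openSegment ℝ z w)
  rw [hC.isOpen.interior_eq] at h
  have h2 := hC.smul_mem 2 (by norm_num) _ h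
  rwa [smul_add, smul_smul, smul_smul, mul_one_div_cancel (by norm_num), one_smul,
    one_smul] at h2

lemma SharpCone.closure_smul_mem {C : Set V} (hC : SharpCone C) {t : ℝ} (ht : 0 < t) {z : V}
    (hz : z ∈ closure C) : t • z ∈ closure C :=
  map_mem_closure (continuous_const_smul t) hz fun x hx => hC.smul_mem t ht x hx

lemma SharpCone.zero_mem_closure {C : Set V} (hC : SharpCone C) : (0 : V) ∈ closure C := by
  obtain ⟨z, hz⟩ := hC.nonempty
  have h : Tendsto (fun t : ℝ => t • z) (nhdsWithin 0 (Ioi 0)) (nhds 0) := by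
    have : Tendsto (fun t : ℝ => t • z) (nhds 0) (nhds ((0 : ℝ) • z)) :=
      (continuous_id.smul continuous_const).tendsto 0
    rw [zero_smul] at this
    exact this.mono_left nhdsWithin_le_nhds
  exact mem_closure_of_tendsto h
    (by filter_upwards [self_mem_nhdsWithin] with t ht using hC.smul_mem t ht z hz)

lemma SharpCone.closure_smul_mem' {C : Set V} (hC : SharpCone C) {t : ℝ} (ht : 0 ≤ t) {z : V}
    (hz : z ∈ closure C) : t • z ∈ closure C := by
  rcases ht.eq_or_lt with rfl | ht
  · rw [zero_smul]; exact hC.zero_mem_closure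
  · exact hC.closure_smul_mem ht hz

lemma SharpCone.closure_add_mem {C : Set V} (hC : SharpCone C) {z w : V} (hz : z ∈ closure C)
    (hw : w ∈ closure C) : z + w ∈ closure C :=
  closure_minimal (t := (· + w) ⁻¹' closure C)
    (fun _ hx => subset_closure (hC.add_mem hx hw))
    (isClosed_closure.preimage (continuous_id.add continuous_const)) hz

variable [FiniteDimensional ℝ V]

lemma exists_tendsto_of_norm_le {X : Type*} [SeminormedAddCommGroup X] [ProperSpace X]
    (l : Ultrafilter ℕ) {u : ℕ → X} {R : ℝ} (h : ∀ᶠ n in (l : Filter ℕ), ‖u n‖ ≤ R) :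
    ∃ x, Tendsto u l (nhds x) := by
  obtain ⟨x, -, hx⟩ := (isCompact_closedBall (0 : X) R).ultrafilter_le_nhds' (l.map u)
    (h.mono fun n hn => by simpa using hn)
  exact ⟨x, hx⟩

lemma SharpCone.image {U : Type*} [NormedAddCommGroup U] [NormedSpace ℝ U]
    {C : Set V} (hC : SharpCone C) (e : V ≃ₗ[ℝ] U) : SharpCone (e '' C) := by
  have : FiniteDimensional ℝ U := e.finiteDimensional
  let E := e.toContinuousLinearEquiv.toHomeomorph
  have hcl : closure (e '' C) = e '' closure C := (E.image_closure C).symm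
  refine ⟨E.isOpenMap _ hC.isOpen, hC.convex.linear_image e.toLinearMap, ?_,
    hC.nonempty.image e, ?_⟩
  · rintro t ht _ ⟨x, hx, rfl⟩
    exact ⟨t • x, hC.smul_mem t ht x hx, map_smul e t x⟩
  · rw [hcl]
    rintro _ ⟨x, hx, rfl⟩ ⟨y, hy, hxy⟩
    have : y = -x := e.injective (by rw [hxy, map_neg])
    rw [hC.eq_zero x hx (this ▸ hy), map_zero]

lemma CocompactCone.image {U : Type*} [NormedAddCommGroup U] [NormedSpace ℝ U]
    {C : Set V} (hC : CocompactCone C) (e : V ≃ₗ[ℝ] U) : CocompactCone (e '' C) := by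
  have : FiniteDimensional ℝ U := e.finiteDimensional
  obtain ⟨K, hKC, hK, h⟩ := hC
  refine ⟨e '' K, image_mono hKC, hK.image e.toContinuousLinearEquiv.continuous, ?_⟩
  rintro _ ⟨x, hx, rfl⟩
  obtain ⟨A, hA, hAx⟩ := h x hx
  refine ⟨(e.symm.trans A).trans e, ?_, ⟨A x, hAx, by simp⟩⟩
  rw [image_image]
  conv_rhs => rw [← hA, image_image]
  simp

lemma exists_eventually_norm_le_of_mapsTo (l : Ultrafilter ℕ) {S T : ℕ → Set V} {S' T' : Set V}
    (hS' : IsOpen S') (hT' : ∀ z ∈ closure T', -z ∈ closure T' → z = 0)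
    (hTs : ∀ n, ∀ t : ℝ, 0 < t → ∀ z ∈ T n, t • z ∈ T n)
    (hS : ∀ u : ℕ → V, ∀ x ∈ S', Tendsto u l (nhds x) → ∀ᶠ n in (l : Filter ℕ), u n ∈ S n)
    (hT : ∀ u : ℕ → V, ∀ x, Tendsto u l (nhds x) → (∀ᶠ n in (l : Filter ℕ), u n ∈ T n) →
      x ∈ closure T')
    {A : ℕ → V →L[ℝ] V} (hA : ∀ n, MapsTo (A n) (S n) (T n))
    {p : ℕ → V} {p₀ q : V} (hp₀ : p₀ ∈ S') (hp : Tendsto p l (nhds p₀))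
    (hq : Tendsto (fun n => A n (p n)) l (nhds q)) :
    ∃ R : ℝ, ∀ᶠ n in (l : Filter ℕ), ‖A n‖ ≤ R := by
  have : ProperSpace V := FiniteDimensional.proper_real V
  by_contra! hcon
  have hlarge : Tendsto (fun n => ‖A n‖) l atTop := by
    refine tendsto_atTop.2 fun R => ?_
    filter_upwards [hcon R] with n hn using hn.le
  have hv : ∀ n, ∃ v : V, ‖v‖ < 1 ∧ ‖A n‖ - 1 < ‖A n v‖ := fun n =>
    (A n).exists_lt_apply_of_lt_opNorm (by linarith)
  choose v hv1 hv2 using hv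
  have ha : Tendsto (fun n => ‖A n (v n)‖) l atTop :=
    tendsto_atTop_mono (fun n => (hv2 n).le) (tendsto_atTop_add_const_right _ (-1) hlarge)
  have hainv : Tendsto (fun n => ‖A n (v n)‖⁻¹) l (nhds 0) := tendsto_inv_atTop_zero.comp ha
  have hapos := ha.eventually_gt_atTop 0
  obtain ⟨v₀, hv₀⟩ := exists_tendsto_of_norm_le l (u := v) (R := 1)
    (Eventually.of_forall fun n => (hv1 n).le)
  have hun : ∀ᶠ n in (l : Filter ℕ), ‖‖A n (v n)‖⁻¹ • A n (v n)‖ = 1 := by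
    filter_upwards [hapos] with n hn
    rw [norm_smul, norm_inv, norm_norm, inv_mul_cancel₀ hn.ne']
  obtain ⟨u, hu⟩ := exists_tendsto_of_norm_le l (hun.mono fun n hn => hn.le)
  have hu1 : ‖u‖ = 1 :=
    tendsto_nhds_unique hu.norm (tendsto_const_nhds.congr' (hun.mono fun n hn => hn.symm))
  have key : ∀ᶠ δ in nhds (0 : ℝ), p₀ + δ • v₀ ∈ S' := by
    have : Tendsto (fun δ : ℝ => p₀ + δ • v₀) (nhds 0) (nhds (p₀ + (0 : ℝ) • v₀)) :=
      (continuous_const.add (continuous_id.smul continuous_const)).tendsto 0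
    rw [zero_smul, add_zero] at this
    exact this (hS'.mem_nhds hp₀)
  have hmem : ∀ δ : ℝ, p₀ + δ • v₀ ∈ S' → δ • u ∈ closure T' := by
    intro δ hδ
    have h1 := hS (fun n => p n + δ • v n) _ hδ (hp.add (hv₀.const_smul δ))
    refine hT (fun n => ‖A n (v n)‖⁻¹ • A n (p n + δ • v n)) _ ?_ ?_
    · have h2 : Tendsto (fun n => ‖A n (v n)‖⁻¹ • A n (p n) +
          δ • (‖A n (v n)‖⁻¹ • A n (v n))) l (nhds ((0 : ℝ) • q + δ • u)) :=
        (hainv.smul hq).add (hu.const_smul δ)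
      rw [zero_smul, zero_add] at h2
      refine h2.congr fun n => ?_
      rw [map_add, map_smul, smul_add, smul_comm]
    · filter_upwards [h1, hapos] with n hn hpos
      exact hTs n _ (inv_pos.2 hpos) _ (hA n hn)
  obtain ⟨ε, hε, hball⟩ := Metric.eventually_nhds_iff.1 key
  have h1 : (ε / 2) • u ∈ closure T' := hmem _ (hball (by
    rw [Real.dist_eq, sub_zero, abs_of_pos (half_pos hε)]; exact half_lt_self hε))
  have h2 : -((ε / 2) • u) ∈ closure T' := by
    rw [← neg_smul]
    exact hmem _ (hball (by
      rw [Real.dist_eq, sub_zero, abs_neg, abs_of_pos (half_pos hε)]; exact half_lt_self hε))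
  have h3 := hT' _ h1 h2
  rw [smul_eq_zero] at h3
  rcases h3 with h3 | h3
  · linarith
  · rw [h3, norm_zero] at hu1
    exact zero_ne_one hu1

/-- Every sharp limit of images of a cocompact cone is a linear image of that cone. -/
theorem CocompactCone.exists_image_eq_of_limit {C C' : Set V} (hC : SharpCone C)
    (hC' : SharpCone C') (hco : CocompactCone C) (g : ℕ → V ≃ₗ[ℝ] V)
    (hin : ∀ x ∈ C', ∀ᶠ p : V × ℕ in nhds x ×ˢ atTop, p.1 ∈ g p.2 '' C)
    (hout : ∀ x, x ∉ closure C' → ∀ᶠ p : V × ℕ in nhds x ×ˢ atTop, p.1 ∉ g p.2 '' C) :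
    ∃ A : V ≃ₗ[ℝ] V, A '' C = C' := by
  have : ProperSpace V := FiniteDimensional.proper_real V
  have : ProperSpace (V →L[ℝ] V) := FiniteDimensional.proper_real _
  obtain ⟨K, hKC, hK, htr⟩ := hco
  obtain ⟨x, hx⟩ := hC'.nonempty
  set l : Ultrafilter ℕ := hyperfilter ℕ with hl
  have hlt : (l : Filter ℕ) ≤ atTop := by
    rw [hl, ← Nat.cofinite_eq_atTop]; exact hyperfilter_le_cofinite
  have hin' : ∀ u : ℕ → V, ∀ y ∈ C', Tendsto u l (nhds y) →
      ∀ᶠ n in (l : Filter ℕ), u n ∈ g n '' C := fun u y hy hu =>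
    (hu.prodMk (tendsto_id.mono_right hlt)).eventually (hin y hy)
  have hout' : ∀ u : ℕ → V, ∀ y, Tendsto u l (nhds y) →
      (∀ᶠ n in (l : Filter ℕ), u n ∈ g n '' C) → y ∈ closure C' := by
    intro u y hu hmem
    by_contra hy
    have := (hu.prodMk (tendsto_id.mono_right hlt)).eventually (hout y hy)
    obtain ⟨n, hn1, hn2⟩ := (this.and hmem).exists
    exact hn1 hn2
  have hsel : ∀ n, ∃ B : V ≃ₗ[ℝ] V, B '' C = C ∧ (x ∈ g n '' C → B ((g n).symm x) ∈ K) := by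
    intro n
    by_cases h : x ∈ g n '' C
    · obtain ⟨z, hz, hzx⟩ := h
      obtain ⟨B, hB, hBz⟩ := htr z hz
      exact ⟨B, hB, fun _ => by rwa [← hzx, LinearEquiv.symm_apply_apply]⟩
    · exact ⟨LinearEquiv.refl ℝ V, image_id C, fun h' => absurd h' h⟩
  choose B hB hBK using hsel
  let e : ℕ → V ≃ₗ[ℝ] V := fun n => (B n).symm.trans (g n)
  have heC : ∀ n, e n '' C = g n '' C := by
    intro n
    have : (fun z => (B n).symm z) '' C = C := by
      conv_lhs => rw [← hB n]
      simp only [image_image, LinearEquiv.symm_apply_apply, image_id']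
    change (fun z => g n ((B n).symm z)) '' C = _
    rw [← image_image (g n) (fun z => (B n).symm z), this]
  have hesC : ∀ n, ∀ y ∈ g n '' C, (e n).symm y ∈ C := by
    intro n y hy
    rw [← heC n] at hy
    obtain ⟨z, hz, rfl⟩ := hy
    rwa [LinearEquiv.symm_apply_apply]
  have hxev : ∀ᶠ n in (l : Filter ℕ), x ∈ g n '' C := hin' (fun _ => x) x hx tendsto_const_nhds
  obtain ⟨k, hkK, hk⟩ := hK.ultrafilter_le_nhds' (l.map fun n => (e n).symm x)
    (hxev.mono fun n hn => hBK n hn)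
  have hk : Tendsto (fun n => (e n).symm x) l (nhds k) := hk
  have hgs : ∀ n, ∀ t : ℝ, 0 < t → ∀ z ∈ g n '' C, t • z ∈ g n '' C := by
    rintro n t ht _ ⟨z, hz, rfl⟩
    exact ⟨t • z, hC.smul_mem t ht z hz, map_smul _ _ _⟩
  let E : ℕ → V →L[ℝ] V := fun n => (e n).toContinuousLinearEquiv
  let E' : ℕ → V →L[ℝ] V := fun n => (e n).symm.toContinuousLinearEquiv
  obtain ⟨R, hR⟩ := exists_eventually_norm_le_of_mapsTo l (S := fun _ => C)
    (T := fun n => g n '' C) (A := E) hC.isOpen hC'.eq_zero hgs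
    (fun u y hy hu => hu (hC.isOpen.mem_nhds hy)) hout'
    (fun n z hz => by rw [← heC n]; exact ⟨z, hz, rfl⟩) (hKC hkK) hk
    (q := x) (tendsto_const_nhds.congr fun n => ((e n).apply_symm_apply x).symm)
  obtain ⟨R', hR'⟩ := exists_eventually_norm_le_of_mapsTo l (S := fun n => g n '' C)
    (T := fun _ => C) (A := E') hC'.isOpen hC.eq_zero (fun _ => hC.smul_mem)
    hin' (fun u y hu hm => mem_closure_of_tendsto hu hm)
    (fun n z hz => hesC n z hz) hx (p := fun _ => x) tendsto_const_nhds hk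
  obtain ⟨A, hA⟩ := exists_tendsto_of_norm_le l hR
  obtain ⟨A', hA'⟩ := exists_tendsto_of_norm_le l hR'
  have happ : ∀ {F : ℕ → V →L[ℝ] V} {F₀ : V →L[ℝ] V}, Tendsto F l (nhds F₀) → ∀ z,
      Tendsto (fun n => F n z) l (nhds (F₀ z)) := fun hF z =>
    ((ContinuousLinearMap.apply ℝ V z).continuous.tendsto _).comp hF
  have h1 : A * A' = 1 := tendsto_nhds_unique (hA.mul hA')
    (tendsto_const_nhds.congr fun n => by
      ext z; exact ((e n).apply_symm_apply z).symm)
  have h2 : A' * A = 1 := tendsto_nhds_unique (hA'.mul hA)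
    (tendsto_const_nhds.congr fun n => by
      ext z; exact ((e n).symm_apply_apply z).symm)
  have h1' : ∀ z, A (A' z) = z := fun z => congrArg (fun f : V →L[ℝ] V => f z) h1
  have h2' : ∀ z, A' (A z) = z := fun z => congrArg (fun f : V →L[ℝ] V => f z) h2
  let Aₑ : V ≃ₗ[ℝ] V := LinearEquiv.ofLinearMap A.toLinearMap A'.toLinearMap
    (LinearMap.ext h1') (LinearMap.ext h2')
  have open_closure : ∀ {D : Set V}, SharpCone D → ∀ {O : Set V}, IsOpen O → O ⊆ closure D →
      O ⊆ D := by
    intro D hD O hO hOD z hz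
    obtain ⟨w, hw⟩ := hD.nonempty
    have hc : Tendsto (fun δ : ℝ => z - δ • w) (nhdsWithin 0 (Ioi 0)) (nhds z) := by
      have : Tendsto (fun δ : ℝ => z - δ • w) (nhds 0) (nhds (z - (0 : ℝ) • w)) :=
        (continuous_const.sub (continuous_id.smul continuous_const)).tendsto 0
      rw [zero_smul, sub_zero] at this
      exact this.mono_left nhdsWithin_le_nhds
    obtain ⟨δ, hδ1, hδ2⟩ := ((hc.eventually (hO.mem_nhds hz)).and self_mem_nhdsWithin).exists
    have := hD.add_mem (hD.smul_mem δ hδ2 w hw) (hOD hδ1)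
    rwa [add_sub_cancel] at this
  refine ⟨Aₑ, Subset.antisymm ?_ ?_⟩
  · refine open_closure hC' ((hC.image Aₑ).isOpen) ?_
    rintro _ ⟨z, hz, rfl⟩
    exact hout' _ _ (happ hA z)
      (Eventually.of_forall fun n => by rw [← heC n]; exact ⟨z, hz, rfl⟩)
  · intro y hy
    refine ⟨A' y, ?_, h1' y⟩
    refine open_closure hC ((hC'.image Aₑ.symm).isOpen) ?_ ⟨y, hy, rfl⟩
    rintro _ ⟨z, hz, rfl⟩
    exact mem_closure_of_tendsto (happ hA' z)
      ((hin' (fun _ => z) z hz tendsto_const_nhds).mono fun n hn => hesC n z hn)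

end ConeLimits

/-- Coordinates adapted to a flat: its hyperplane is the vanishing locus of the last one. -/
abbrev Coord (d : ℕ) := (Fin d → ℝ) × ℝ

/-- The vertices of the flat in adapted coordinates. -/
def axis {d : ℕ} (j : Fin d) : Coord d := (Pi.single j 1, 0)

/-- A sharp cocompact indecomposable cone lying over the positive orthant, of which the positive
orthant is a flat. -/
structure FlatCone {d : ℕ} (C : Set (Coord d)) : Prop extends SharpCone C where
  cocompact : CocompactCone C
  not_split : ¬ SplitCone C
  pos : ∀ z ∈ C, ∀ j, 0 < z.1 j
  base : ∀ x : Fin d → ℝ, (∀ j, 0 < x j) → (x, (0 : ℝ)) ∈ C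

/-- Multiplication of the `j`-th orthant coordinate by `s`. -/
def axisScale {d : ℕ} (j : Fin d) (s : ℝ) : Coord d →ₗ[ℝ] Coord d :=
  LinearMap.id + (s - 1) • ((LinearMap.proj j).comp (LinearMap.fst ℝ _ ℝ)).smulRight (axis j)

section FlatCones

variable {d : ℕ}

lemma axisScale_apply (j : Fin d) (s : ℝ) (z : Coord d) :
    axisScale j s z = z + ((s - 1) * z.1 j) • axis j := by
  simp [axisScale, smul_smul]

lemma fst_add_smul_axis (j : Fin d) (c : ℝ) (z : Coord d) :
    (z + c • axis j).1 j = z.1 j + c := by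
  simp [axis]

lemma axisScale_axisScale (j : Fin d) (s t : ℝ) (z : Coord d) :
    axisScale j s (axisScale j t z) = axisScale j (s * t) z := by
  rw [axisScale_apply, axisScale_apply, axisScale_apply, fst_add_smul_axis]
  module

lemma axisScale_one (j : Fin d) (z : Coord d) : axisScale j 1 z = z := by
  rw [axisScale_apply]; simp

lemma continuous_axisScale (j : Fin d) (s : ℝ) : Continuous (axisScale j s) :=
  (axisScale j s).continuous_of_finiteDimensional

/-- `axisScale` as a linear automorphism. -/
def axisScaleEquiv (j : Fin d) (s : ℝ) (hs : s ≠ 0) : Coord d ≃ₗ[ℝ] Coord d :=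
  LinearEquiv.ofLinearMap (axisScale j s) (axisScale j s⁻¹)
    (LinearMap.ext fun z => by
      rw [LinearMap.comp_apply, axisScale_axisScale, mul_inv_cancel₀ hs, axisScale_one]; rfl)
    (LinearMap.ext fun z => by
      rw [LinearMap.comp_apply, axisScale_axisScale, inv_mul_cancel₀ hs, axisScale_one]; rfl)

lemma mem_axisScaleEquiv_image (j : Fin d) (s : ℝ) (hs : s ≠ 0) (C : Set (Coord d))
    (z : Coord d) : z ∈ axisScaleEquiv j s hs '' C ↔ axisScale j s⁻¹ z ∈ C := by
  constructor
  · rintro ⟨y, hy, rfl⟩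
    change axisScale j s⁻¹ (axisScale j s y) ∈ C
    rwa [axisScale_axisScale, inv_mul_cancel₀ hs, axisScale_one]
  · intro h
    refine ⟨_, h, ?_⟩
    change axisScale j s (axisScale j s⁻¹ z) = z
    rw [axisScale_axisScale, mul_inv_cancel₀ hs, axisScale_one]

lemma SharpCone.split_of_axisScale {C : Set (Coord d)} (hC : SharpCone C) (j : Fin d)
    (hpos : ∀ z ∈ C, 0 < z.1 j) (hinv : ∀ s : ℝ, 0 < s → ∀ z ∈ C, axisScale j s z ∈ C) :
    SplitCone C := by
  let p : Coord d →ₗ[ℝ] ℝ := (LinearMap.proj j).comp (LinearMap.fst ℝ _ ℝ)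
  have hp : ∀ z, p z = z.1 j := fun z => rfl
  have hpa : p (axis j) = 1 := by simp [hp, axis]
  have hcompl : IsCompl (LinearMap.ker p) (ℝ ∙ axis j) := by
    refine ⟨?_, ?_⟩
    · rw [Submodule.disjoint_def]
      intro z hz hz'
      obtain ⟨c, rfl⟩ := Submodule.mem_span_singleton.1 hz'
      rw [LinearMap.mem_ker, map_smul, hpa, smul_eq_mul, mul_one] at hz
      rw [hz, zero_smul]
    · rw [Submodule.codisjoint_iff_exists_add_eq]
      intro z
      refine ⟨z - p z • axis j, p z • axis j, ?_, ?_, by abel⟩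
      · rw [LinearMap.mem_ker, map_sub, map_smul, hpa, smul_eq_mul, mul_one, sub_self]
      · exact Submodule.smul_mem _ _ (Submodule.mem_span_singleton_self _)
  have hbot₁ : LinearMap.ker p ≠ ⊥ := by
    intro h
    have : ((0, 1) : Coord d) ∈ LinearMap.ker p := by simp [hp]
    rw [h, Submodule.mem_bot] at this
    exact one_ne_zero (congrArg Prod.snd this)
  have hbot₂ : (ℝ ∙ axis j) ≠ ⊥ := by
    intro h
    rw [Submodule.span_singleton_eq_bot] at h
    rw [h, map_zero] at hpa
    exact zero_ne_one hpa
  refine ⟨LinearMap.ker p, ℝ ∙ axis j, {z | z.1 j = 0 ∧ ∃ r : ℝ, z + r • axis j ∈ C},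
    {z | ∃ r : ℝ, 0 < r ∧ z = r • axis j}, hbot₁, hbot₂, ?_, ?_, hcompl, ?_, ?_, ?_, ?_, ?_, ?_, ?_⟩
  · intro h
    rw [h] at hcompl
    exact hbot₂ (by simpa using hcompl.disjoint)
  · intro h
    rw [h] at hcompl
    exact hbot₁ (by simpa using hcompl.disjoint)
  · rintro z ⟨hz, -⟩
    exact hz
  · rintro _ ⟨r, -, rfl⟩
    exact Submodule.smul_mem _ _ (Submodule.mem_span_singleton_self _)
  · rintro z ⟨hz, r, hr⟩ z' ⟨hz', r', hr'⟩ a b ha hb hab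
    refine ⟨by simp [hz, hz'], a * r + b * r', ?_⟩
    convert hC.convex hr hr' ha hb hab using 1
    module
  · rintro _ ⟨r, hr, rfl⟩ _ ⟨r', hr', rfl⟩ a b ha hb hab
    refine ⟨a * r + b * r', ?_, by module⟩
    rcases ha.eq_or_lt with rfl | ha
    · rw [zero_add] at hab; subst hab; simpa using hr'
    · have := mul_pos ha hr
      have := mul_nonneg hb hr'.le
      linarith
  · rintro t ht z ⟨hz, r, hr⟩
    refine ⟨by simp [hz], t * r, ?_⟩
    convert hC.smul_mem t ht _ hr using 1
    module
  · rintro t ht _ ⟨r, hr, rfl⟩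
    exact ⟨t * r, mul_pos ht hr, by module⟩
  · ext z
    constructor
    · intro hz
      refine ⟨z + (-z.1 j) • axis j, ⟨by rw [fst_add_smul_axis, add_neg_cancel], z.1 j, ?_⟩,
        z.1 j • axis j, ⟨z.1 j, hpos z hz, rfl⟩, by module⟩
      convert hz using 1
      module
    · rintro ⟨y, ⟨hy, r', hr'⟩, _, ⟨r, hr, rfl⟩, rfl⟩
      have hr'0 := hpos _ hr'
      rw [fst_add_smul_axis, hy, zero_add] at hr'0
      convert hinv (r / r') (div_pos hr hr'0) _ hr' using 1
      rw [axisScale_apply, fst_add_smul_axis, hy, zero_add, sub_one_mul,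
        div_mul_cancel₀ _ hr'0.ne']
      module

namespace FlatCone

variable {C : Set (Coord d)}

lemma nonneg_of_mem_closure (hC : FlatCone C) {z : Coord d} (hz : z ∈ closure C) (j : Fin d) :
    0 ≤ z.1 j :=
  closure_minimal (t := {z : Coord d | 0 ≤ z.1 j}) (fun z hz => (hC.pos z hz j).le)
    (isClosed_le continuous_const (by fun_prop)) hz

lemma base_mem_closure (hC : FlatCone C) {x : Fin d → ℝ} (hx : ∀ j, 0 ≤ x j) :
    (x, (0 : ℝ)) ∈ closure C := by
  have h : Tendsto (fun δ : ℝ => ((fun i => x i + δ, 0) : Coord d)) (nhdsWithin 0 (Ioi 0))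
      (nhds (x, 0)) := by
    have : Continuous (fun δ : ℝ => ((fun i => x i + δ, 0) : Coord d)) := by fun_prop
    have := this.tendsto 0
    simp only [add_zero] at this
    exact this.mono_left nhdsWithin_le_nhds
  exact mem_closure_of_tendsto h (by
    filter_upwards [self_mem_nhdsWithin] with δ hδ
    exact hC.base _ fun j => add_pos_of_nonneg_of_pos (hx j) hδ)

lemma smul_axis_mem_closure (hC : FlatCone C) (j : Fin d) {c : ℝ} (hc : 0 ≤ c) :
    c • axis j ∈ closure C := by
  have := hC.base_mem_closure (x := c • Pi.single j 1) fun i => by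
    by_cases h : i = j
    · subst h; simpa using hc
    · simp [h]
  simpa [axis, Prod.smul_mk] using this

lemma axisScale_mono (hC : FlatCone C) {j : Fin d} {s t : ℝ} (hs : 0 < s) (hst : s ≤ t)
    {z : Coord d} (hz : axisScale j s z ∈ C) : axisScale j t z ∈ C := by
  have hz0 := hC.pos _ hz j
  rw [axisScale_apply, fst_add_smul_axis] at hz0
  have hzj : 0 ≤ z.1 j := by nlinarith
  convert hC.add_mem hz (hC.smul_axis_mem_closure j (mul_nonneg (sub_nonneg.2 hst) hzj)) using 1
  rw [axisScale_apply, axisScale_apply]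
  module

lemma limit_not_invariant (hC : FlatCone C) {C' : Set (Coord d)} (hC' : SharpCone C') (j : Fin d)
    (hpos : ∀ z ∈ C', 0 < z.1 j) (hinv : ∀ s : ℝ, 0 < s → ∀ z ∈ C', axisScale j s z ∈ C')
    (g : ℕ → Coord d ≃ₗ[ℝ] Coord d)
    (hin : ∀ x ∈ C', ∀ᶠ p : Coord d × ℕ in nhds x ×ˢ atTop, p.1 ∈ g p.2 '' C)
    (hout : ∀ x, x ∉ closure C' → ∀ᶠ p : Coord d × ℕ in nhds x ×ˢ atTop, p.1 ∉ g p.2 '' C) :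
    False := by
  obtain ⟨A, hA⟩ := hC.cocompact.exists_image_eq_of_limit hC.toSharpCone hC' g hin hout
  refine hC.not_split ?_
  have h := (hC'.split_of_axisScale j hpos hinv).image A.symm
  rw [← hA, image_image] at h
  simpa using h

open Pointwise in
/-- Over the boundary of the orthant the cone closes up. -/
lemma snd_eq_zero (hC : FlatCone C) {z : Coord d} (hz : z ∈ closure C) {j : Fin d}
    (hzj : z.1 j = 0) : z.2 = 0 := by
  by_contra hz2
  let D : Set (Coord d) := {y | ∀ s : ℝ, 0 < s → axisScale j s y ∈ closure C}
  have hDclosed : IsClosed D := by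
    have : D = ⋂ s : ℝ, ⋂ _ : 0 < s, axisScale j s ⁻¹' closure C := by ext; simp [D]
    rw [this]
    exact isClosed_iInter fun s => isClosed_iInter fun _ =>
      isClosed_closure.preimage (continuous_axisScale j s)
  have hDadd : ∀ y ∈ D, ∀ y' ∈ D, y + y' ∈ D := fun y hy y' hy' s hs => by
    rw [map_add]; exact hC.closure_add_mem (hy s hs) (hy' s hs)
  have hDsmul : ∀ t : ℝ, 0 ≤ t → ∀ y ∈ D, t • y ∈ D := fun t ht y hy s hs => by
    rw [map_smul]; exact hC.closure_smul_mem' ht (hy s hs)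
  have hDconv : Convex ℝ D := fun y hy y' hy' a b ha hb _ =>
    hDadd _ (hDsmul a ha y hy) _ (hDsmul b hb y' hy')
  have hDC : D ⊆ closure C := fun y hy => by
    have := hy 1 one_pos
    rwa [axisScale_one] at this
  have hzD : z ∈ D := fun s _ => by rwa [axisScale_apply, hzj, mul_zero, zero_smul, add_zero]
  have hbD : ∀ x : Fin d → ℝ, (∀ i, 0 ≤ x i) → ((x, 0) : Coord d) ∈ D := by
    intro x hx s hs
    have : axisScale j s (x, 0) = (fun i => if i = j then s * x i else x i, 0) := by
      rw [axisScale_apply]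
      ext i
      · by_cases h : i = j
        · subst h; simp [axis]; ring
        · simp [axis, h]
      · simp [axis]
    rw [this]
    refine hC.base_mem_closure fun i => ?_
    split_ifs
    · exact mul_nonneg hs.le (hx i)
    · exact hx i
  have hDscale : ∀ s : ℝ, 0 < s → ∀ y ∈ D, axisScale j s y ∈ D := fun s hs y hy t ht => by
    rw [axisScale_axisScale]; exact hy _ (mul_pos ht hs)
  have hDint : (interior D).Nonempty := by
    let O : Set (Coord d) := {y | 0 < y.2 / z.2} ∩ ⋂ i, {y | 0 < y.1 i - y.2 / z.2 * z.1 i}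
    have hO : IsOpen O := by
      refine (isOpen_lt continuous_const (by fun_prop)).inter
        (isOpen_iInter_of_finite fun i => isOpen_lt continuous_const (by fun_prop))
    have hOD : O ⊆ D := by
      rintro y ⟨hy1, hy2⟩
      rw [mem_iInter] at hy2
      have h := hDadd _ (hDsmul _ (le_of_lt hy1) z hzD) _
        (hbD (fun i => y.1 i - y.2 / z.2 * z.1 i) fun i => (hy2 i).le)
      convert h using 1
      ext i
      · simp
      · simp [hz2]
    refine ⟨z + (fun _ => 1, 0), interior_maximal hOD hO ⟨?_, ?_⟩⟩
    · simp [hz2]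
    · simp [hz2]
  have hcl : closure (interior D) = D := by
    rw [hDconv.closure_interior_eq_closure_of_nonempty_interior hDint, hDclosed.closure_eq]
  have hsharp : SharpCone (interior D) := by
    refine ⟨isOpen_interior, hDconv.interior, ?_, hDint, ?_⟩
    · intro t ht y hy
      have : t • interior D ⊆ D := by
        rintro _ ⟨y, hy, rfl⟩
        exact hDsmul t ht.le y (interior_subset hy)
      exact interior_maximal this (isOpen_interior.smul₀ ht.ne') (smul_mem_smul_set hy)
    · rw [hcl]
      exact fun y hy hy' => hC.eq_zero y (hDC hy) (hDC hy')
  have hintC : interior D ⊆ C := by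
    have := interior_mono hDC
    rwa [hC.convex.interior_closure_eq_interior_of_nonempty_interior
      (by rw [hC.isOpen.interior_eq]; exact hC.nonempty), hC.isOpen.interior_eq] at this
  have hscale : ∀ s : ℝ, 0 < s → ∀ y ∈ interior D, axisScale j s y ∈ interior D := by
    intro s hs y hy
    have hopen : IsOpen ((axisScaleEquiv j s hs.ne') '' interior D) :=
      (axisScaleEquiv j s hs.ne').toContinuousLinearEquiv.toHomeomorph.isOpenMap _ isOpen_interior
    refine interior_maximal ?_ hopen ⟨y, hy, rfl⟩
    rintro _ ⟨y, hy, rfl⟩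
    exact hDscale s hs y (interior_subset hy)
  have hn : ∀ n : ℕ, ((n : ℝ) + 1) ≠ 0 := fun n => by positivity
  refine hC.limit_not_invariant hsharp j (fun y hy => hC.pos y (hintC hy) j) hscale
    (fun n => axisScaleEquiv j (n + 1) (hn n)) ?_ ?_
  · intro x hx
    have h1 : ∀ᶠ y in nhds x, y ∈ interior D := isOpen_interior.mem_nhds hx
    filter_upwards [h1.prod_inl atTop] with p hp
    rw [mem_axisScaleEquiv_image]
    exact hintC (hscale _ (by positivity) _ hp)
  · intro x hx
    rw [hcl] at hx
    simp only [D, mem_ofPred_eq, not_forall] at hx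
    obtain ⟨s, hs, hsx⟩ := hx
    have h1 : ∀ᶠ y in nhds x, axisScale j s y ∉ closure C :=
      (isClosed_closure.preimage (continuous_axisScale j s)).isOpen_compl.mem_nhds hsx
    have h2 : ∀ᶠ n : ℕ in atTop, ((n : ℝ) + 1)⁻¹ ≤ s := by
      have := tendsto_one_div_add_atTop_nhds_zero_nat (𝕜 := ℝ)
      filter_upwards [this.eventually_le_const hs] with n hn
      rwa [one_div] at hn
    filter_upwards [h1.prod_mk h2] with p hp hmem
    rw [mem_axisScaleEquiv_image] at hmem
    exact hp.1 (subset_closure (hC.axisScale_mono (by positivity) hp.2 hmem))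

/-- Every point over the open orthant enters the cone when translated along an axis. -/
lemma exists_add_axis_mem (hC : FlatCone C) {z : Coord d} (hz : ∀ i, 0 < z.1 i) (j : Fin d) :
    ∃ c : ℝ, 0 ≤ c ∧ z + c • axis j ∈ C := by
  by_contra! hcon
  have hscale_not : ∀ s : ℝ, 0 < s → axisScale j s z ∉ C := by
    intro s hs hmem
    have := hC.axisScale_mono hs (le_max_left s 1) hmem
    rw [axisScale_apply] at this
    exact hcon _ (mul_nonneg (sub_nonneg.2 (le_max_right _ _)) (hz j).le) this
  have hz2 : z.2 ≠ 0 := by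
    intro h
    have : z ∈ C := by
      have := hC.base z.1 hz
      rwa [← h] at this
    exact hcon 0 le_rfl (by rwa [zero_smul, add_zero])
  let D : Set (Coord d) := {y | ∃ s : ℝ, 0 < s ∧ axisScale j s y ∈ C}
  have hDopen : IsOpen D := by
    have : D = ⋃ s : ℝ, ⋃ _ : 0 < s, axisScale j s ⁻¹' C := by ext; simp [D]
    rw [this]
    exact isOpen_iUnion fun s => isOpen_iUnion fun _ =>
      hC.isOpen.preimage (continuous_axisScale j s)
  have hCD : C ⊆ D := fun y hy => ⟨1, one_pos, by rwa [axisScale_one]⟩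
  have hDpos : ∀ y ∈ D, ∀ i, 0 < y.1 i := by
    rintro y ⟨s, hs, hy⟩ i
    have := hC.pos _ hy i
    rw [axisScale_apply] at this
    by_cases h : i = j
    · subst h
      rw [fst_add_smul_axis] at this
      have h2 : 0 < s * y.1 i := by linarith
      exact pos_of_mul_pos_right h2 hs.le
    · simpa [axis, h] using this
  have hDclpos : ∀ y ∈ closure D, ∀ i, 0 ≤ y.1 i := fun y hy i =>
    closure_minimal (t := {z : Coord d | 0 ≤ z.1 i}) (fun z hz => (hDpos z hz i).le)
      (isClosed_le continuous_const (by fun_prop)) hy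
  have hDsmul : ∀ t : ℝ, 0 < t → ∀ y ∈ D, t • y ∈ D := by
    rintro t ht y ⟨s, hs, hy⟩
    exact ⟨s, hs, by rw [map_smul]; exact hC.smul_mem t ht _ hy⟩
  have hDconv : Convex ℝ D := by
    rintro y ⟨s, hs, hy⟩ y' ⟨s', hs', hy'⟩ a b ha hb hab
    refine ⟨max s s', lt_max_of_lt_left hs, ?_⟩
    rw [map_add, map_smul, map_smul]
    exact hC.convex (hC.axisScale_mono hs (le_max_left _ _) hy)
      (hC.axisScale_mono hs' (le_max_right _ _) hy') ha hb hab
  have hvert : ((0, z.2) : Coord d) ∉ closure D := by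
    intro h
    have h1 := hDconv.openSegment_interior_closure_subset_interior
      (x := (z.1, 0)) (by rw [hDopen.interior_eq]; exact hCD (hC.base z.1 hz)) h
      ⟨1 / 2, 1 / 2, by norm_num, by norm_num, by norm_num, rfl⟩
    rw [hDopen.interior_eq] at h1
    have h2 := hDsmul 2 (by norm_num) _ h1
    obtain ⟨s, hs, hmem⟩ := h2
    refine hscale_not s hs ?_
    convert hmem using 2
    ext i <;> simp
  have hsharp : SharpCone D := by
    refine ⟨hDopen, hDconv, hDsmul, hC.nonempty.mono hCD, ?_⟩
    intro y hy hy'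
    have hy1 : y.1 = 0 := by
      ext i
      have h1 := hDclpos y hy i
      have h2 := hDclpos _ hy' i
      simp only [Prod.fst_neg, Pi.neg_apply] at h2
      simp only [Pi.zero_apply]; linarith
    have hscl : ∀ t : ℝ, 0 < t → ∀ y ∈ closure D, t • y ∈ closure D := fun t ht y hy =>
      map_mem_closure (continuous_const_smul t) hy fun x hx => hDsmul t ht x hx
    by_contra hne
    have hy2 : y.2 ≠ 0 := fun h => hne (Prod.ext hy1 h)
    rcases lt_or_gt_of_ne (div_ne_zero hz2 hy2) with h | h
    · refine hvert ?_
      convert hscl (-(z.2 / y.2)) (neg_pos.2 h) _ hy' using 1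
      ext i <;> simp [hy1, hy2]
    · refine hvert ?_
      convert hscl (z.2 / y.2) h _ hy using 1
      ext i <;> simp [hy1, hy2]
  have hn : ∀ n : ℕ, ((n : ℝ) + 1)⁻¹ ≠ 0 := fun n => by positivity
  refine hC.limit_not_invariant hsharp j (fun y hy => hDpos y hy j) ?_
    (fun n => axisScaleEquiv j ((n : ℝ) + 1)⁻¹ (hn n)) ?_ ?_
  · rintro s hs y ⟨t, ht, hy⟩
    exact ⟨t / s, div_pos ht hs, by rwa [axisScale_axisScale, div_mul_cancel₀ _ hs.ne']⟩
  · rintro x ⟨s, hs, hx⟩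
    have h1 : ∀ᶠ y in nhds x, axisScale j s y ∈ C :=
      (hC.isOpen.preimage (continuous_axisScale j s)).mem_nhds hx
    have h2 : ∀ᶠ n : ℕ in atTop, s ≤ (n : ℝ) + 1 := by
      filter_upwards [eventually_ge_atTop ⌈s⌉₊] with n hn
      have := (Nat.le_ceil s).trans (Nat.cast_le.2 hn)
      linarith
    filter_upwards [h1.prod_mk h2] with p hp
    rw [mem_axisScaleEquiv_image, inv_inv]
    exact hC.axisScale_mono hs hp.2 hp.1
  · intro x hx
    have h1 : ∀ᶠ y in nhds x, y ∉ closure D := isClosed_closure.isOpen_compl.mem_nhds hx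
    filter_upwards [h1.prod_inl atTop] with p hp hmem
    rw [mem_axisScaleEquiv_image, inv_inv] at hmem
    exact hp (subset_closure ⟨_, by positivity, hmem⟩)

lemma sum_fst_nonneg (hC : FlatCone C) {z : Coord d} (hz : z ∈ closure C) : 0 ≤ ∑ j, z.1 j :=
  Finset.sum_nonneg fun j _ => hC.nonneg_of_mem_closure hz j

lemma sum_fst_pos [NeZero d] (hC : FlatCone C) {z : Coord d} (hz : z ∈ closure C) (h0 : z ≠ 0) :
    0 < ∑ j, z.1 j := by
  refine (hC.sum_fst_nonneg hz).lt_of_ne' fun h => h0 ?_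
  have h1 := (Finset.sum_eq_zero_iff_of_nonneg
    fun j _ => hC.nonneg_of_mem_closure hz j).1 h
  exact Prod.ext (funext fun j => h1 j (Finset.mem_univ j))
    (hC.snd_eq_zero hz (h1 (0 : Fin d) (Finset.mem_univ _)))

lemma exists_norm_le_sum_fst [NeZero d] (hC : FlatCone C) :
    ∃ R : ℝ, ∀ z ∈ closure C, ‖z‖ ≤ R * ∑ j, z.1 j := by
  have hK : IsCompact (closure C ∩ sphere (0 : Coord d) 1) :=
    (isCompact_sphere 0 1).inter_left isClosed_closure
  obtain ⟨a, ha, hle⟩ := hK.exists_forall_le' (f := fun z : Coord d => ∑ j, z.1 j) (a := 0)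
    (by fun_prop) fun z hz => hC.sum_fst_pos hz.1 (ne_of_mem_sphere hz.2 one_ne_zero)
  refine ⟨a⁻¹, fun z hz => ?_⟩
  rcases eq_or_ne z 0 with rfl | h0
  · simp
  have hn : 0 < ‖z‖ := norm_pos_iff.2 h0
  have h1 := hle (‖z‖⁻¹ • z) ⟨hC.closure_smul_mem (inv_pos.2 hn) hz, by
    simp [norm_smul, inv_mul_cancel₀ hn.ne']⟩
  simp only [Prod.smul_fst, Pi.smul_apply, smul_eq_mul, ← Finset.mul_sum] at h1
  rw [inv_mul_eq_div, le_div_iff₀ hn] at h1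
  rwa [inv_mul_eq_div, le_div_iff₀ ha, mul_comm]

lemma exists_snd_lt_mem (hC : FlatCone C) :
    ∃ δ : ℝ, 0 < δ ∧ ∀ s : ℝ, |s| < δ → ((1, s) : Coord d) ∈ C := by
  have h : ∀ᶠ s : ℝ in nhds 0, ((1, s) : Coord d) ∈ C := by
    have hc : Continuous fun s : ℝ => ((1, s) : Coord d) := by fun_prop
    exact hc.continuousAt.eventually_mem (hC.isOpen.mem_nhds (hC.base 1 fun _ => one_pos))
  obtain ⟨δ, hδ, h⟩ := Metric.eventually_nhds_iff.1 h
  exact ⟨δ, hδ, fun s hs => h (by rwa [Real.dist_eq, sub_zero])⟩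

end FlatCone

/-- The hyperplane `{z | z.2 = L ⬝ᵥ z.1}` meets the closure of `C` in the cone over a simplex
none of whose edges enters `C`; the vertices are normalised to have coordinate sum `1`. -/
def WeakFlat (C : Set (Coord d)) (L : Fin d → ℝ) : Prop :=
  ∃ w : Fin d → Coord d, (∀ i, w i ∈ closure C) ∧ (∀ i, ∑ j, (w i).1 j = 1) ∧
    (∀ i, (w i).2 = L ⬝ᵥ (w i).1) ∧
    (∀ i j, ∀ a b : ℝ, 0 ≤ a → 0 ≤ b → a • w i + b • w j ∉ C) ∧
    (∀ z ∈ C, z.2 = L ⬝ᵥ z.1 → ∃ c : Fin d → ℝ, (∀ i, 0 ≤ c i) ∧ z = ∑ i, c i • w i)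

lemma FlatCone.weakFlat_of_vertices [NeZero d] {C : Set (Coord d)} (hC : FlatCone C)
    {L : Fin d → ℝ} (w : Fin d → Coord d) (hw : ∀ i, w i ∈ closure C) (hw0 : ∀ i, w i ≠ 0)
    (hL : ∀ i, (w i).2 = L ⬝ᵥ (w i).1)
    (hedge : ∀ i j, ∀ a b : ℝ, 0 ≤ a → 0 ≤ b → a • w i + b • w j ∉ C)
    (hhull : ∀ z ∈ C, z.2 = L ⬝ᵥ z.1 →
      ∃ c : Fin d → ℝ, (∀ i, 0 ≤ c i) ∧ z = ∑ i, c i • w i) : WeakFlat C L := by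
  let r : Fin d → ℝ := fun i => ∑ j, (w i).1 j
  have hr : ∀ i, 0 < r i := fun i => hC.sum_fst_pos (hw i) (hw0 i)
  refine ⟨fun i => (r i)⁻¹ • w i, fun i => hC.closure_smul_mem (inv_pos.2 (hr i)) (hw i),
    fun i => ?_, fun i => ?_, fun i j a b ha hb => ?_, fun z hz hzL => ?_⟩
  · simp only [Prod.smul_fst, Pi.smul_apply, smul_eq_mul, ← Finset.mul_sum]
    exact inv_mul_cancel₀ (hr i).ne'
  · simp [hL]
  · rw [smul_smul, smul_smul]
    exact hedge i j _ _ (mul_nonneg ha (inv_pos.2 (hr i)).le) (mul_nonneg hb (inv_pos.2 (hr j)).le)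
  · obtain ⟨c, hc, rfl⟩ := hhull z hz hzL
    refine ⟨fun i => c i * r i, fun i => mul_nonneg (hc i) (hr i).le,
      Finset.sum_congr rfl fun i _ => ?_⟩
    rw [smul_smul, mul_assoc, mul_inv_cancel₀ (hr i).ne', mul_one]

lemma sum_fst_sum_smul {w : Fin d → Coord d} (hw : ∀ i, ∑ j, (w i).1 j = 1) (c : Fin d → ℝ) :
    ∑ j, (∑ i, c i • w i).1 j = ∑ i, c i := by
  simp only [Prod.fst_sum, Finset.sum_apply, Prod.smul_fst, Pi.smul_apply, smul_eq_mul]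
  rw [Finset.sum_comm]
  simp [← Finset.mul_sum, hw]

/-- Limits of points of simplicial cones with convergent normalised vertices. -/
lemma exists_nonneg_combination_of_tendsto (l : Ultrafilter ℕ) {w : ℕ → Fin d → Coord d}
    {w' : Fin d → Coord d} (hw : ∀ i, Tendsto (fun n => w n i) l (nhds (w' i)))
    {z : ℕ → Coord d} {z' : Coord d} (hz : Tendsto z l (nhds z'))
    (h : ∀ᶠ n in (l : Filter ℕ), (∀ i, ∑ j, (w n i).1 j = 1) ∧
      ∃ c : Fin d → ℝ, (∀ i, 0 ≤ c i) ∧ z n = ∑ i, c i • w n i) :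
    ∃ c : Fin d → ℝ, (∀ i, 0 ≤ c i) ∧ z' = ∑ i, c i • w' i := by
  obtain ⟨h1, h2⟩ := eventually_and.1 h
  obtain ⟨c, hc⟩ := h2.choice
  have htot : Tendsto (fun n => ∑ j, (z n).1 j) l (nhds (∑ j, z'.1 j)) := by
    have : Continuous fun y : Coord d => ∑ j, y.1 j := by fun_prop
    exact (this.tendsto z').comp hz
  have hbdd : ∀ᶠ n in (l : Filter ℕ), ‖c n‖ ≤ ∑ j, z'.1 j + 1 := by
    filter_upwards [h1, hc, htot.eventually_le_const (lt_add_one _)] with n hn1 ⟨hn2, hn3⟩ hn4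
    rw [hn3, sum_fst_sum_smul hn1] at hn4
    refine (pi_norm_le_iff_of_nonneg ((Finset.sum_nonneg fun i _ => hn2 i).trans hn4)).2
      fun i => ?_
    rw [Real.norm_of_nonneg (hn2 i)]
    exact (Finset.single_le_sum (fun i _ => hn2 i) (Finset.mem_univ i)).trans hn4
  obtain ⟨c', hc'⟩ := exists_tendsto_of_norm_le l hbdd
  rw [tendsto_pi_nhds] at hc'
  refine ⟨c', fun i => ge_of_tendsto (hc' i) (hc.mono fun n hn => hn.1 i), ?_⟩
  refine tendsto_nhds_unique hz ?_
  refine (tendsto_finsetSum Finset.univ fun i _ => (hc' i).smul (hw i)).congr' ?_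
  filter_upwards [hc] with n hn
  exact hn.2.symm

namespace FlatCone

variable {C : Set (Coord d)}

lemma exists_forall_ne_zero_of_weakFlat (hC : FlatCone C) :
    ∃ ε : ℝ, 0 < ε ∧ ∀ L : Fin d → ℝ, WeakFlat C L → L ≠ 0 → ‖L‖ ≤ ε → ∀ j, L j ≠ 0 := by
  obtain ⟨δ, hδ, hδC⟩ := hC.exists_snd_lt_mem
  refine ⟨δ / (d + 2), by positivity, fun L ⟨w, hw, hw1, hwL, hedge, hhull⟩ hL0 hLε j hLj => ?_⟩
  have hLi : ∀ i, |L i| ≤ δ / (d + 2) := fun i => (norm_le_pi_norm L i).trans hLε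
  have hsum : |L ⬝ᵥ 1| ≤ d * (δ / (d + 2)) := by
    rw [dotProduct_one]
    refine (Finset.abs_sum_le_sum_abs _ _).trans ((Finset.sum_le_card_nsmul _ _ _
      fun i _ => hLi i).trans_eq ?_)
    simp
  have hδ' : (d + 2) * (δ / (d + 2)) = δ := by field_simp
  have hδ0 : 0 < δ / (d + 2) := by positivity
  have hone : ((1, L ⬝ᵥ 1) : Coord d) ∈ C := hδC _ (by linarith)
  have hadd : ∀ k, ((1, L ⬝ᵥ 1 + L k) : Coord d) ∈ C := fun k => hδC _ (by
    linarith [abs_add_le (L ⬝ᵥ 1) (L k), hLi k])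
  have haxis : ∃ c : Fin d → ℝ, (∀ i, 0 ≤ c i) ∧ axis j = ∑ i, c i • w i := by
    have hlim : Tendsto (fun n : ℕ => axis j + (1 / ((n : ℝ) + 1)) • ((1, L ⬝ᵥ 1) : Coord d))
        atTop (nhds (axis j)) := by
      have := (tendsto_one_div_add_atTop_nhds_zero_nat (𝕜 := ℝ)).smul_const
        ((1, L ⬝ᵥ 1) : Coord d)
      simpa using this.const_add (axis j)
    refine exists_nonneg_combination_of_tendsto (hyperfilter ℕ) (w := fun _ => w)
      (fun i => tendsto_const_nhds) (hlim.mono_left Nat.hyperfilter_le_atTop)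
      (Eventually.of_forall fun n => ⟨hw1, hhull _ ?_ ?_⟩)
    · rw [add_comm]
      refine hC.add_mem (hC.smul_mem _ (by positivity) _ hone) ?_
      simpa using hC.smul_axis_mem_closure j zero_le_one
    · simp [axis, dotProduct_add, hLj]
  obtain ⟨c, hc, hca⟩ := haxis
  obtain ⟨i, hi⟩ : ∃ i, 0 < c i := by
    by_contra! h
    have h0 : ∀ i, c i = 0 := fun i => le_antisymm (h i) (hc i)
    simp only [h0, zero_smul, Finset.sum_const_zero] at hca
    have := congrFun (congrArg Prod.fst hca) j
    simp [axis] at this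
  have hwk : ∀ k, k ≠ j → (w i).1 k = 0 := by
    intro k hk
    have h1 := congrFun (congrArg Prod.fst hca) k
    simp only [axis, Pi.single_eq_of_ne hk, Prod.fst_sum, Finset.sum_apply, Prod.smul_fst,
      Pi.smul_apply, smul_eq_mul] at h1
    have h2 := (Finset.sum_eq_zero_iff_of_nonneg fun i _ =>
      mul_nonneg (hc i) (hC.nonneg_of_mem_closure (hw i) k)).1 h1.symm i (Finset.mem_univ i)
    exact (mul_eq_zero.1 h2).resolve_left hi.ne'
  have hwj : (w i).1 j = 1 := by
    rw [← hw1 i]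
    exact (Finset.sum_eq_single j (fun k _ hk => hwk k hk) (by simp)).symm
  have hw1' : (w i).1 = Pi.single j 1 := by
    ext k
    by_cases hk : k = j
    · subst hk; simp [hwj]
    · simp [hk, hwk k hk]
  have hwi : w i = axis j := by
    refine Prod.ext hw1' ?_
    rw [hwL, hw1', dotProduct_single, hLj]
    simp [axis]
  obtain ⟨z, hzC, hzL, hz2⟩ : ∃ z ∈ C, z.2 = L ⬝ᵥ z.1 ∧ z.2 ≠ 0 := by
    by_cases h : L ⬝ᵥ 1 = 0
    · obtain ⟨k, hk⟩ := Function.ne_iff.1 hL0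
      refine ⟨(1, L ⬝ᵥ 1 + L k) + axis k, hC.add_mem (hadd k)
        (by simpa using hC.smul_axis_mem_closure k zero_le_one), ?_, ?_⟩
      · simp [axis, dotProduct_add]
      · simpa [axis, h] using hk
    · exact ⟨_, hone, rfl, h⟩
  obtain ⟨c', hc', rfl⟩ := hhull z hzC hzL
  obtain ⟨m, hm⟩ : ∃ m, (w m).2 ≠ 0 := by
    by_contra! h
    exact hz2 (by simp [Prod.snd_sum, h])
  obtain ⟨t, ht, htC⟩ := hC.exists_add_axis_mem (z := w m) (fun k =>
    (hC.nonneg_of_mem_closure (hw m) k).lt_of_ne' fun h => hm (hC.snd_eq_zero (hw m) h)) j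
  refine hedge m i 1 t zero_le_one ht ?_
  rwa [one_smul, hwi]

lemma weakFlat_of_tendsto [NeZero d] (hC : FlatCone C) (l : Ultrafilter ℕ)
    {L : ℕ → Fin d → ℝ} {L' : Fin d → ℝ} (hL : Tendsto L l (nhds L'))
    (h : ∀ n, WeakFlat C (L n)) : WeakFlat C L' := by
  choose w hw hw1 hwL hedge hhull using h
  obtain ⟨R, hR⟩ := hC.exists_norm_le_sum_fst
  have hlim : ∀ i, ∃ y, Tendsto (fun n => w n i) l (nhds y) := fun i =>
    exists_tendsto_of_norm_le (R := R) l (Eventually.of_forall fun n => by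
      simpa [hw1] using hR _ (hw n i))
  choose w' hw' using hlim
  refine ⟨w', fun i => isClosed_closure.mem_of_tendsto (hw' i) (Eventually.of_forall
    fun n => hw n i), fun i => ?_, fun i => ?_, fun i j a b ha hb hmem => ?_, fun z hz hzL => ?_⟩
  · have hc : Continuous fun y : Coord d => ∑ j, y.1 j := by fun_prop
    refine tendsto_nhds_unique ((hc.tendsto _).comp (hw' i)) ?_
    simp only [Function.comp_def, hw1]
    exact tendsto_const_nhds
  · refine tendsto_nhds_unique ((continuous_snd.tendsto _).comp (hw' i)) ?_
    simp only [Function.comp_def, hwL]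
    have hc : Continuous fun p : (Fin d → ℝ) × Coord d => p.1 ⬝ᵥ p.2.1 :=
      continuous_fst.dotProduct (by fun_prop)
    exact (hc.tendsto (L', w' i)).comp (hL.prodMk_nhds (hw' i))
  · have ht := ((hw' i).const_smul a).add ((hw' j).const_smul b)
    obtain ⟨n, hn⟩ := (ht.eventually_mem (hC.isOpen.mem_nhds hmem)).exists
    exact hedge n i j a b ha hb hn
  · have hzn : Tendsto (fun n => ((z.1, L n ⬝ᵥ z.1) : Coord d)) l (nhds z) := by
      have hc : Continuous fun M : Fin d → ℝ => ((z.1, M ⬝ᵥ z.1) : Coord d) :=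
        continuous_const.prodMk (continuous_id.dotProduct continuous_const)
      have := (hc.tendsto L').comp hL
      rwa [← hzL] at this
    refine exists_nonneg_combination_of_tendsto l hw' hzn ?_
    filter_upwards [hzn.eventually_mem (hC.isOpen.mem_nhds hz)] with n hn
    exact ⟨hw1 n, hhull n _ hn rfl⟩

lemma weakFlat_div [NeZero d] (hC : FlatCone C) {lam : Fin d → ℝ} (hpos : ∀ j, 0 < lam j)
    (hinv : ∀ z : Coord d, z ∈ C ↔ (lam * z.1, z.2) ∈ C) {L : Fin d → ℝ} (h : WeakFlat C L) :
    WeakFlat C (L / lam) := by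
  obtain ⟨w, hw, hw1, hwL, hedge, hhull⟩ := h
  have hdiv : ∀ x : Fin d → ℝ, lam * (x / lam) = x := fun x =>
    funext fun j => mul_div_cancel₀ _ (hpos j).ne'
  have hdot : ∀ x : Fin d → ℝ, (L / lam) ⬝ᵥ (lam * x) = L ⬝ᵥ x := fun x =>
    Finset.sum_congr rfl fun j _ => by
      have := (hpos j).ne'
      simp only [Pi.div_apply, Pi.mul_apply]
      field_simp
  let S : Coord d → Coord d := fun z => (lam * z.1, z.2)
  have hS : ∀ (a b : ℝ) (y z : Coord d), a • S y + b • S z = S (a • y + b • z) := fun a b y z => by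
    ext j <;> simp [S]; ring
  refine hC.weakFlat_of_vertices (fun i => S (w i)) (fun i => ?_) (fun i h0 => ?_) (fun i => ?_)
    (fun i j a b ha hb hmem => ?_) (fun z hz hzL => ?_)
  · exact map_mem_closure (by fun_prop) (hw i) fun z hz => (hinv z).1 hz
  · have h1 : ∀ j, (w i).1 j = 0 := fun j => by
      have := congrFun (congrArg Prod.fst h0) j
      simpa [S, (hpos j).ne'] using this
    have := hw1 i
    simp [h1] at this
  · simp only [S]
    rw [hdot, hwL]
  · rw [hS, ← hinv] at hmem
    exact hedge i j a b ha hb hmem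
  · have hzS : (lam * (z.1 / lam), z.2) = z := by rw [hdiv]
    obtain ⟨c, hc, hcz⟩ := hhull (z.1 / lam, z.2) ((hinv _).2 (by rwa [hzS])) (by
      simp only
      rw [← hdot, hdiv, hzL])
    refine ⟨c, hc, ?_⟩
    rw [← hzS]
    ext j
    · have := congrFun (congrArg Prod.fst hcz) j
      simp only [Prod.fst_sum, Finset.sum_apply, Prod.smul_fst, Pi.smul_apply, smul_eq_mul] at this
      simp only [S, Prod.fst_sum, Finset.sum_apply, Prod.smul_fst, Pi.smul_apply, smul_eq_mul,
        Pi.mul_apply, this, Finset.mul_sum]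
      exact Finset.sum_congr rfl fun i _ => by ring
    · have := congrArg Prod.snd hcz
      simp only [Prod.snd_sum, Prod.smul_snd] at this
      simp only [S, Prod.snd_sum, Prod.smul_snd, this]

lemma weakFlat_div_pow [NeZero d] (hC : FlatCone C) {lam : Fin d → ℝ} (hpos : ∀ j, 0 < lam j)
    (hinv : ∀ z : Coord d, z ∈ C ↔ (lam * z.1, z.2) ∈ C) {L : Fin d → ℝ} (h : WeakFlat C L)
    (k : ℕ) : WeakFlat C (L / lam ^ k) := by
  induction k with
  | zero => simpa using h
  | succ k ih => simpa [pow_succ, div_div] using hC.weakFlat_div hpos hinv ih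

lemma exists_one_le_of_invariant [NeZero d] (hC : FlatCone C) {lam : Fin d → ℝ}
    (hpos : ∀ j, 0 < lam j) (hinv : ∀ z : Coord d, z ∈ C ↔ (lam * z.1, z.2) ∈ C) :
    ∃ j, 1 ≤ lam j := by
  by_contra! hlt
  obtain ⟨δ, hδ, hδC⟩ := hC.exists_snd_lt_mem
  have hmem : ∀ n : ℕ, ((lam ^ n, δ / 2) : Coord d) ∈ C := by
    intro n
    induction n with
    | zero => simpa using hδC (δ / 2) (by rw [abs_of_pos (by positivity)]; linarith)
    | succ n ih => simpa [pow_succ'] using (hinv _).1 ih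
  have hlim : Tendsto (fun n : ℕ => ((lam ^ n, δ / 2) : Coord d)) atTop (nhds (0, δ / 2)) := by
    refine Tendsto.prodMk_nhds (tendsto_pi_nhds.2 fun j => ?_) tendsto_const_nhds
    exact tendsto_pow_atTop_nhds_zero_of_lt_one (hpos j).le (hlt j)
  have h0 := hC.snd_eq_zero (mem_closure_of_tendsto hlim (Eventually.of_forall hmem))
    (j := (0 : Fin d)) rfl
  simp only at h0
  linarith

lemma eq_zero_of_weakFlat_of_lt_one [NeZero d] (hC : FlatCone C) {lam : Fin d → ℝ}
    (hpos : ∀ j, 0 < lam j) (hinv : ∀ z : Coord d, z ∈ C ↔ (lam * z.1, z.2) ∈ C)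
    {j₂ : Fin d} (hj₂ : lam j₂ < 1) :
    ∃ ε : ℝ, 0 < ε ∧ ∀ L : Fin d → ℝ, WeakFlat C L → ‖L‖ < ε → L = 0 := by
  obtain ⟨j₁, hj₁⟩ := hC.exists_one_le_of_invariant hpos hinv
  obtain ⟨ε, hε, hne⟩ := hC.exists_forall_ne_zero_of_weakFlat
  obtain ⟨M, hM1, hM⟩ : ∃ M : ℝ, 1 ≤ M ∧ ∀ j, (lam j)⁻¹ ≤ M := by
    refine ⟨1 + ∑ j, (lam j)⁻¹, ?_, fun j => ?_⟩
    · have := Finset.sum_nonneg fun j (_ : j ∈ Finset.univ) => (inv_pos.2 (hpos j)).le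
      linarith
    · have := Finset.single_le_sum (fun j _ => (inv_pos.2 (hpos j)).le) (Finset.mem_univ j)
      linarith
  have hM0 : 0 < M := by linarith
  by_contra! hcon
  have key : ∀ n : ℕ, ∃ L : Fin d → ℝ, WeakFlat C L ∧ ε / M ≤ ‖L‖ ∧ ‖L‖ ≤ ε ∧
      |L j₁| ≤ ε * (1 / ((n : ℝ) + 1)) := by
    intro n
    obtain ⟨L, hWL, hLn, hL0⟩ := hcon (ε / M * (1 / ((n : ℝ) + 1))) (by positivity)
    have hn1 : 1 / ((n : ℝ) + 1) ≤ 1 := by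
      rw [div_le_one (by positivity)]
      linarith [(Nat.cast_nonneg n : (0 : ℝ) ≤ n)]
    have hεM : ε / M ≤ ε := div_le_self hε.le hM1
    have hLM : ‖L‖ < ε / M := hLn.trans_le (mul_le_of_le_one_right (by positivity) hn1)
    have hLj : 0 < |L j₂| := abs_pos.2 (hne L hWL hL0 (hLM.le.trans hεM) j₂)
    have hex : ∃ k : ℕ, ε / M < ‖L / lam ^ k‖ := by
      obtain ⟨k, hk⟩ := pow_unbounded_of_one_lt (ε / M / |L j₂|) ((one_lt_inv₀ (hpos j₂)).2 hj₂)
      refine ⟨k, ?_⟩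
      rw [div_lt_iff₀ hLj] at hk
      refine hk.trans_le (le_trans ?_ (norm_le_pi_norm _ j₂))
      rw [Pi.div_apply, Pi.pow_apply, norm_div, norm_pow, Real.norm_of_nonneg (hpos j₂).le,
        inv_pow, inv_mul_eq_div, Real.norm_eq_abs]
    classical
    let k := Nat.find hex
    have hk : ε / M < ‖L / lam ^ k‖ := Nat.find_spec hex
    obtain ⟨m, hm⟩ : ∃ m, k = m + 1 := by
      refine Nat.exists_eq_succ_of_ne_zero fun h0 => ?_
      rw [h0, pow_zero, div_one] at hk
      linarith
    have hmle : ‖L / lam ^ m‖ ≤ ε / M := not_lt.1 (Nat.find_min hex (m := m) (by omega))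
    refine ⟨L / lam ^ k, hC.weakFlat_div_pow hpos hinv hWL k, hk.le, ?_, ?_⟩
    · refine (pi_norm_le_iff_of_nonneg hε.le).2 fun j => ?_
      have h1 : ‖(L / lam ^ m) j‖ ≤ ε / M := (norm_le_pi_norm _ j).trans hmle
      have h2 : (L / lam ^ k) j = (L / lam ^ m) j * (lam j)⁻¹ := by
        simp only [hm, pow_succ, Pi.div_apply, Pi.mul_apply, Pi.pow_apply, div_eq_mul_inv, mul_inv]
        ring
      rw [h2, norm_mul, Real.norm_of_nonneg (inv_pos.2 (hpos j)).le]
      calc _ ≤ ε / M * M := mul_le_mul h1 (hM j) (inv_pos.2 (hpos j)).le (by positivity)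
        _ = ε := div_mul_cancel₀ _ hM0.ne'
    · rw [Pi.div_apply, Pi.pow_apply, abs_div, abs_of_pos (pow_pos (hpos j₁) k)]
      refine (div_le_self (abs_nonneg _) (one_le_pow₀ hj₁)).trans
        ((norm_le_pi_norm L j₁).trans (hLn.le.trans ?_))
      exact mul_le_mul_of_nonneg_right hεM (by positivity)
  choose L hWL hlow hup hj using key
  obtain ⟨L', hL'⟩ := exists_tendsto_of_norm_le (hyperfilter ℕ) (Eventually.of_forall hup)
  have hW' := hC.weakFlat_of_tendsto (hyperfilter ℕ) hL' hWL
  have hn1 : ‖L'‖ ≤ ε := le_of_tendsto hL'.norm (Eventually.of_forall hup)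
  have hn2 : ε / M ≤ ‖L'‖ := ge_of_tendsto hL'.norm (Eventually.of_forall hlow)
  have hL0 : L' ≠ 0 := norm_pos_iff.1 (lt_of_lt_of_le (by positivity) hn2)
  refine hne L' hW' hL0 hn1 j₁ (abs_eq_zero.1 (le_antisymm ?_ (abs_nonneg _)))
  have hz : Tendsto (fun n : ℕ => ε * (1 / ((n : ℝ) + 1))) (hyperfilter ℕ) (nhds 0) := by
    simpa using ((tendsto_one_div_add_atTop_nhds_zero_nat (𝕜 := ℝ)).const_mul ε).mono_left
      Nat.hyperfilter_le_atTop
  exact le_of_tendsto_of_tendsto' ((tendsto_pi_nhds.1 hL' j₁).abs) hz hj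

/-- If a non-homothetic diagonal automorphism preserves the cone, the base flat is isolated. -/
theorem eq_zero_of_weakFlat [NeZero d] (hC : FlatCone C) {lam : Fin d → ℝ}
    (hpos : ∀ j, 0 < lam j) (hinv : ∀ z : Coord d, z ∈ C ↔ (lam * z.1, z.2) ∈ C)
    {j : Fin d} (hj : lam j ≠ 1) :
    ∃ ε : ℝ, 0 < ε ∧ ∀ L : Fin d → ℝ, WeakFlat C L → ‖L‖ < ε → L = 0 := by
  rcases hj.lt_or_gt with h | h
  · exact hC.eq_zero_of_weakFlat_of_lt_one hpos hinv h
  · refine hC.eq_zero_of_weakFlat_of_lt_one (lam := lam⁻¹) (fun i => inv_pos.2 (hpos i))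
      (fun z => ?_) (j₂ := j) (inv_lt_one_of_one_lt₀ h)
    have h1 : lam * (lam⁻¹ * z.1) = z.1 := funext fun i => mul_inv_cancel_left₀ (hpos i).ne' _
    rw [hinv (lam⁻¹ * z.1, z.2)]
    simp only [h1]

end FlatCone

end FlatCones

section SimplexFlats

variable {V : Type*} [NormedAddCommGroup V] [NormedSpace ℝ V] {d : ℕ} {C : Set V} {v : Fin d → V}

/-- The open simplicial cone spanned by `v` lies in `C` and its proper faces do not meet `C`. -/
structure SimplexFlat (C : Set V) (v : Fin d → V) : Prop where
  indep : LinearIndependent ℝ v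
  mem : ∀ c : Fin d → ℝ, (∀ j, 0 < c j) → ∑ j, c j • v j ∈ C
  notMem : ∀ c : Fin d → ℝ, (∀ j, 0 ≤ c j) → (∃ j, c j = 0) → ∑ j, c j • v j ∉ C

lemma sum_single_smul (v : Fin d → V) (j : Fin d) :
    ∑ i, (Pi.single j 1 : Fin d → ℝ) i • v i = v j := by
  simp [Pi.single_apply]

namespace SimplexFlat

lemma exists_pos_of_mem_span [NeZero d] (hF : SimplexFlat C v) (hC : Convex ℝ C) {z : V}
    (hz : z ∈ C) (hzv : z ∈ Submodule.span ℝ (range v)) :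
    ∃ c : Fin d → ℝ, (∀ j, 0 < c j) ∧ z = ∑ j, c j • v j := by
  obtain ⟨c, rfl⟩ := (Submodule.mem_span_range_iff_exists_fun ℝ).1 hzv
  refine ⟨c, ?_, rfl⟩
  by_contra! hcon
  obtain ⟨i, hi⟩ := hcon
  obtain ⟨k, hk⟩ := Finite.exists_min c
  have hck : c k ≤ 0 := (hk i).trans hi
  let t := 1 / (1 - c k)
  have ht0 : 0 < t := by have : 0 < 1 - c k := by linarith
                         positivity
  have ht1 : t ≤ 1 := by
    rw [div_le_one (by linarith)]; linarith
  have htk : 1 - t + t * c k = 0 := by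
    have : t * (1 - c k) = 1 := div_mul_cancel₀ _ (by linarith)
    linarith
  refine hF.notMem (fun j => 1 - t + t * c j) (fun j => ?_) ⟨k, htk⟩ ?_
  · have := mul_le_mul_of_nonneg_left (hk j) ht0.le
    linarith
  · have h1 := hF.mem (fun _ => 1) fun _ => one_pos
    convert hC h1 hz (sub_nonneg.2 ht1) ht0.le (by ring) using 1
    rw [Finset.smul_sum, Finset.smul_sum, ← Finset.sum_add_distrib]
    exact Finset.sum_congr rfl fun j _ => by module

lemma mem_closure (hF : SimplexFlat C v) (j : Fin d) : v j ∈ closure C := by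
  have hlim : Tendsto (fun n : ℕ => v j + (1 / ((n : ℝ) + 1)) • ∑ i, v i) atTop (nhds (v j)) := by
    simpa using ((tendsto_one_div_add_atTop_nhds_zero_nat (𝕜 := ℝ)).smul_const
      (∑ i, v i)).const_add (v j)
  refine mem_closure_of_tendsto hlim (Eventually.of_forall fun n => ?_)
  have hn : (0 : ℝ) < 1 / ((n : ℝ) + 1) := by positivity
  convert hF.mem (fun i => (Pi.single j 1 : Fin d → ℝ) i + 1 / ((n : ℝ) + 1)) (fun i => ?_) using 1
  · simp only [add_smul, Finset.sum_add_distrib, sum_single_smul, Finset.smul_sum]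
  · by_cases h : i = j
    · subst h; simp; positivity
    · simpa [h] using hn

lemma sum_mem (hF : SimplexFlat C v) : ∑ i, v i ∈ C := by
  simpa using hF.mem (fun _ => 1) fun _ => one_pos

lemma exists_nonneg_functional [FiniteDimensional ℝ V] (hF : SimplexFlat C v)
    (hC : SharpCone C) (j : Fin d) :
    ∃ f : V →ₗ[ℝ] ℝ, (∀ z ∈ C, 0 ≤ f z) ∧ f (v j) = 1 ∧ ∀ i, i ≠ j → f (v i) = 0 := by
  let c : Fin d → ℝ := fun i => if i = j then 0 else 1
  have hp := hF.notMem c (fun i => by simp only [c]; split_ifs <;> simp) ⟨j, by simp [c]⟩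
  set p := ∑ i, c i • v i with hpdef
  obtain ⟨f, hf⟩ := geometric_hahn_banach_open_point hC.convex hC.isOpen hp
  have hfp : 0 ≤ f p := by
    obtain ⟨z, hz⟩ := hC.nonempty
    have hlim : Tendsto (fun n : ℕ => 1 / ((n : ℝ) + 1) * f z) atTop (nhds 0) := by
      simpa using (tendsto_one_div_add_atTop_nhds_zero_nat (𝕜 := ℝ)).mul_const (f z)
    refine le_of_tendsto hlim (Eventually.of_forall fun n => ?_)
    have := hf _ (hC.smul_mem (1 / ((n : ℝ) + 1)) (by positivity) z hz)
    rw [map_smul, smul_eq_mul] at this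
    exact this.le
  have hfC : ∀ z ∈ C, f z ≤ 0 := by
    intro z hz
    by_contra! h
    have := hf _ (hC.smul_mem ((f p + 1) / f z) (by positivity) z hz)
    rw [map_smul, smul_eq_mul, div_mul_cancel₀ _ h.ne'] at this
    linarith
  have hfcl : ∀ z ∈ closure C, f z ≤ 0 := fun z hz =>
    closure_minimal (t := {z | f z ≤ 0}) hfC (isClosed_le f.continuous continuous_const) hz
  have hfv : ∀ i, f (v i) ≤ 0 := fun i => hfcl _ (hF.mem_closure i)
  have hsum : f p = ∑ i, c i * f (v i) := by simp [hpdef]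
  have hterm : ∀ i ∈ Finset.univ, c i * f (v i) ≤ 0 := fun i _ => by
    simp only [c]; split_ifs <;> simp [hfv]
  have hzero : ∀ i, i ≠ j → f (v i) = 0 := by
    intro i hi
    have h0 : ∑ i, c i * f (v i) = 0 := le_antisymm (Finset.sum_nonpos hterm) (hsum ▸ hfp)
    simpa [c, hi] using (Finset.sum_eq_zero_iff_of_nonpos hterm).1 h0 i (Finset.mem_univ i)
  have hj : f (v j) < 0 := by
    have h1 := hf _ hF.sum_mem
    rw [map_sum, Finset.sum_eq_single j (fun i _ hi => hzero i hi) (by simp)] at h1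
    have : f p = 0 := by
      rw [hsum]
      exact Finset.sum_eq_zero fun i _ => by
        by_cases hi : i = j
        · simp [c, hi]
        · simp [hzero i hi]
    rwa [this] at h1
  refine ⟨(f (v j))⁻¹ • (f : V →ₗ[ℝ] ℝ), fun z hz => ?_, ?_, fun i hi => ?_⟩
  · simpa using mul_nonneg_of_nonpos_of_nonpos (inv_nonpos.2 hj.le) (hfC z hz)
  · simp [hj.ne]
  · simp [hzero i hi]

/-- The supporting functional at a facet that is extremal in the direction `φ`. -/
lemma exists_extremal_functional [FiniteDimensional ℝ V] (hF : SimplexFlat C v)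
    (hC : SharpCone C) {φ : V →ₗ[ℝ] ℝ} (hφ : φ ≠ 0) (hφv : ∀ i, φ (v i) = 0) (j : Fin d) :
    ∃ h : V →ₗ[ℝ] ℝ, (∀ z ∈ C, 0 ≤ h z) ∧ h (v j) = 1 ∧ (∀ i, i ≠ j → h (v i) = 0) ∧
      ∀ s : ℝ, (∀ z ∈ C, 0 ≤ h z + s * φ z) → s ≤ 0 := by
  obtain ⟨f, hfC, hfj, hfi⟩ := hF.exists_nonneg_functional hC j
  let T : Set ℝ := {s | ∀ z ∈ C, 0 ≤ f z + s * φ z}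
  have h0 : (0 : ℝ) ∈ T := fun z hz => by simpa using hfC z hz
  have hle : ∀ z ∈ C, φ z < 0 → ∀ s ∈ T, s ≤ f z / -φ z := fun z hz hφz s hs => by
    rw [le_div_iff₀ (neg_pos.2 hφz)]
    linarith [hs z hz]
  have hb : BddAbove T := by
    obtain ⟨u, hu⟩ : ∃ u, φ u = 1 := LinearMap.surjective hφ 1
    have hlim : Tendsto (fun n : ℕ => ∑ i, v i - (1 / ((n : ℝ) + 1)) • u) atTop
        (nhds (∑ i, v i)) := by
      simpa using ((tendsto_one_div_add_atTop_nhds_zero_nat (𝕜 := ℝ)).smul_const u).const_sub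
        (∑ i, v i)
    obtain ⟨n, hn⟩ := (hlim.eventually_mem (hC.isOpen.mem_nhds hF.sum_mem)).exists
    refine ⟨_, hle _ hn ?_⟩
    simp only [map_sub, map_sum, hφv, map_smul, hu, Finset.sum_const_zero, smul_eq_mul, mul_one,
      zero_sub, neg_lt_zero]
    positivity
  refine ⟨f + sSup T • φ, fun z hz => ?_, by simp [hφv, hfj], fun i hi => by simp [hφv, hfi i hi],
    fun s hs => ?_⟩
  · simp only [LinearMap.add_apply, LinearMap.smul_apply, smul_eq_mul]
    rcases le_or_gt 0 (φ z) with h | h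
    · exact add_nonneg (hfC z hz) (mul_nonneg (le_csSup hb h0) h)
    · have := csSup_le ⟨0, h0⟩ (hle z hz h)
      rw [le_div_iff₀ (neg_pos.2 h)] at this
      linarith
  · have : sSup T + s ∈ T := fun z hz => by
      have := hs z hz
      simp only [LinearMap.add_apply, LinearMap.smul_apply, smul_eq_mul] at this
      linarith
    linarith [le_csSup hb this]

lemma functional_equivariant {φ h : V →ₗ[ℝ] ℝ} (hφ : φ ≠ 0)
    (hker : LinearMap.ker φ = Submodule.span ℝ (range v)) {A : V ≃ₗ[ℝ] V} (hA : A '' C = C)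
    {lam : Fin d → ℝ} (hlam : ∀ j, 0 < lam j) (hAv : ∀ j, A (v j) = lam j • v j)
    {μ : ℝ} (hμ : 0 < μ) (hAφ : ∀ z, φ (A z) = μ * φ z) {j : Fin d} (hhC : ∀ z ∈ C, 0 ≤ h z)
    (hhi : ∀ i, i ≠ j → h (v i) = 0)
    (hext : ∀ s : ℝ, (∀ z ∈ C, 0 ≤ h z + s * φ z) → s ≤ 0) (z : V) :
    h (A z) = lam j * h z := by
  obtain ⟨u, hu⟩ : ∃ u, φ u = 1 := LinearMap.surjective hφ 1
  let g : V →ₗ[ℝ] ℝ := h.comp A.toLinearMap - lam j • h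
  have hg : ∀ y, g y = h (A y) - lam j * h y := fun y => rfl
  have hgv : Submodule.span ℝ (range v) ≤ LinearMap.ker g := by
    rw [Submodule.span_le]
    rintro _ ⟨i, rfl⟩
    rw [SetLike.mem_coe, LinearMap.mem_ker, hg, hAv, map_smul, smul_eq_mul]
    by_cases hi : i = j
    · rw [hi, sub_self]
    · rw [hhi i hi, mul_zero, mul_zero, sub_self]
  have hgφ : ∀ y, g y = g u * φ y := fun y => by
    have h1 : y - φ y • u ∈ LinearMap.ker g := hgv (by
      rw [← hker, LinearMap.mem_ker, map_sub, map_smul, hu, smul_eq_mul, mul_one, sub_self])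
    rw [LinearMap.mem_ker, map_sub, map_smul, smul_eq_mul] at h1
    linarith
  have hAh : ∀ y, h (A y) = lam j * h y + g u * φ y := fun y => by
    rw [← hgφ, hg]; ring
  have h1 : g u / lam j ≤ 0 := hext _ fun y hy => by
    have h2 := hhC (A y) (hA ▸ mem_image_of_mem A hy)
    rw [hAh] at h2
    have h3 := hlam j
    have : h y + g u / lam j * φ y = (lam j * h y + g u * φ y) / lam j := by field_simp
    rw [this]
    positivity
  have h2 : -(g u / μ) ≤ 0 := hext _ fun y hy => by
    rw [← hA] at hy
    obtain ⟨x, hx, rfl⟩ := hy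
    have h3 := mul_nonneg (hlam j).le (hhC x hx)
    have : h (A x) + -(g u / μ) * φ (A x) = lam j * h x := by
      rw [hAh, hAφ]
      field_simp
      ring
    rwa [this]
  have h3 : g u = 0 := by
    refine le_antisymm ?_ ?_
    · rw [div_le_iff₀ (hlam j), zero_mul] at h1; exact h1
    · rw [neg_nonpos, le_div_iff₀ hμ, zero_mul] at h2; exact h2
  rw [hAh, h3, zero_mul, add_zero]

lemma pos_of_functional_nonneg (hC : SharpCone C) {h : V →ₗ[ℝ] ℝ} {u : V} (hu : h u = 1)
    (hhC : ∀ z ∈ C, 0 ≤ h z) {z : V} (hz : z ∈ C) : 0 < h z := by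
  have hlim : Tendsto (fun n : ℕ => z - (1 / ((n : ℝ) + 1)) • u) atTop (nhds z) := by
    simpa using ((tendsto_one_div_add_atTop_nhds_zero_nat (𝕜 := ℝ)).smul_const u).const_sub z
  obtain ⟨n, hn⟩ := (hlim.eventually_mem (hC.isOpen.mem_nhds hz)).exists
  have := hhC _ hn
  rw [map_sub, map_smul, hu, smul_eq_mul, mul_one] at this
  have hn : (0 : ℝ) < 1 / ((n : ℝ) + 1) := by positivity
  linarith

lemma exists_ker_eq_span [FiniteDimensional ℝ V] (hF : SimplexFlat C v)
    (hdim : Module.finrank ℝ V = d + 1) :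
    ∃ φ : V →ₗ[ℝ] ℝ, φ ≠ 0 ∧ LinearMap.ker φ = Submodule.span ℝ (range v) := by
  have hs : Module.finrank ℝ (Submodule.span ℝ (range v)) = d := by
    simpa using finrank_span_eq_card hF.indep
  obtain ⟨φ, hφ, hle⟩ := Submodule.exists_le_ker_of_lt_top (Submodule.span ℝ (range v))
    (Submodule.lt_top_of_finrank_lt_finrank (by omega))
  have hk := Module.Dual.finrank_ker_add_one_of_ne_zero hφ
  exact ⟨φ, hφ, (Submodule.eq_of_le_of_finrank_eq hle (by omega)).symm⟩

/-- Coordinates in which the simplicial cone spanned by `v` is the positive orthant. -/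
lemma exists_coord [FiniteDimensional ℝ V] (hF : SimplexFlat C v) (hC : SharpCone C)
    (hcoc : CocompactCone C) (hsplit : ¬ SplitCone C) (hdim : Module.finrank ℝ V = d + 1)
    {φ : V →ₗ[ℝ] ℝ} (hφ : φ ≠ 0) (hker : LinearMap.ker φ = Submodule.span ℝ (range v)) :
    ∃ Φ : V ≃ₗ[ℝ] Coord d, FlatCone (Φ '' C) ∧ (∀ j, Φ (v j) = axis j) ∧
      (∀ z, (Φ z).2 = φ z) ∧
      ∀ (A : V ≃ₗ[ℝ] V) (lam : Fin d → ℝ) (μ : ℝ), A '' C = C → (∀ j, 0 < lam j) →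
        (∀ j, A (v j) = lam j • v j) → 0 < μ → (∀ z, φ (A z) = μ * φ z) →
        ∀ z, (Φ (A z)).1 = lam * (Φ z).1 := by
  have hφv : ∀ i, φ (v i) = 0 := fun i => by
    rw [← LinearMap.mem_ker, hker]
    exact Submodule.subset_span (mem_range_self i)
  choose h hhC hhj hhi hext using fun j => hF.exists_extremal_functional hC hφ hφv j
  let Ψ : V →ₗ[ℝ] Coord d := (LinearMap.pi h).prod φ
  have hinj : Function.Injective Ψ := by
    rw [injective_iff_map_eq_zero]
    intro z hz
    have h1 : φ z = 0 := congrArg Prod.snd hz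
    have h2 : ∀ j, h j z = 0 := fun j => congrFun (congrArg Prod.fst hz) j
    rw [← LinearMap.mem_ker, hker] at h1
    obtain ⟨c, rfl⟩ := (Submodule.mem_span_range_iff_exists_fun ℝ).1 h1
    refine Finset.sum_eq_zero fun j _ => ?_
    have h3 := h2 j
    rw [map_sum, Finset.sum_eq_single j (fun i _ hi => by simp [hhi j i hi]) (by simp), map_smul,
      hhj, smul_eq_mul, mul_one] at h3
    rw [h3, zero_smul]
  let Φ := Ψ.linearEquivOfInjective hinj (by simp [hdim])
  have hΦ : ∀ z, Φ z = (fun j => h j z, φ z) := fun z => rfl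
  have hΦv : ∀ j, Φ (v j) = axis j := fun j => by
    rw [hΦ]
    ext i
    · by_cases hi : j = i
      · subst hi; simp [axis, hhj]
      · simp [axis, hhi i j hi, Ne.symm hi]
    · simp [axis, hφv]
  refine ⟨Φ, ⟨hC.image Φ, hcoc.image Φ, fun hs => hsplit ?_, ?_, fun x hx => ?_⟩, hΦv,
    fun z => rfl, fun A lam μ hA hlam hAv hμ hAφ z => ?_⟩
  · have := hs.image Φ.symm
    rw [image_image] at this
    simpa using this
  · rintro _ ⟨z, hz, rfl⟩ j
    exact pos_of_functional_nonneg hC (hhj j) (hhC j) hz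
  · refine ⟨_, hF.mem x hx, ?_⟩
    rw [map_sum]
    simp only [map_smul, hΦv]
    ext i
    · simp [axis, Prod.fst_sum, Finset.sum_apply, Pi.single_apply]
    · simp [axis, Prod.snd_sum]
  · rw [hΦ, hΦ]
    funext j
    exact functional_equivariant hφ hker hA hlam hAv hμ hAφ (hhC j) (hhi j) (hext j) z

/-- If a non-homothetic automorphism of the cone fixes every vertex ray of a flat, then every
flat whose span comes close enough to the vertices has the same span. -/
theorem exists_rigid [FiniteDimensional ℝ V] (hd : 3 ≤ d) (hF : SimplexFlat C v)
    (hC : SharpCone C) (hcoc : CocompactCone C) (hsplit : ¬ SplitCone C)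
    (hdim : Module.finrank ℝ V = d + 1)
    {φ : V →ₗ[ℝ] ℝ} (hφ : φ ≠ 0) (hker : LinearMap.ker φ = Submodule.span ℝ (range v))
    (A : V ≃ₗ[ℝ] V) (lam : Fin d → ℝ) (μ : ℝ) (hA : A '' C = C) (hlam : ∀ j, 0 < lam j)
    (hAv : ∀ j, A (v j) = lam j • v j) (hμ : 0 < μ) (hAφ : ∀ z, φ (A z) = μ * φ z)
    (hne : ∃ j, lam j ≠ μ) :
    ∃ δ : ℝ, 0 < δ ∧ ∀ v' : Fin d → V, SimplexFlat C v' →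
      (∀ j, ∃ y ∈ Submodule.span ℝ (range v'), dist y (v j) < δ) →
      Submodule.span ℝ (range v') = Submodule.span ℝ (range v) := by
  have : NeZero d := ⟨by omega⟩
  obtain ⟨Φ, hFC, hΦv, hΦφ, hΦA⟩ := hF.exists_coord hC hcoc hsplit hdim hφ hker
  have hinv : ∀ z : Coord d, z ∈ Φ '' C ↔ (lam / (fun _ => μ) * z.1, z.2) ∈ Φ '' C := by
    intro z
    obtain ⟨x, rfl⟩ := Φ.surjective z
    have h1 : (lam / (fun _ => μ) * (Φ x).1, (Φ x).2) = Φ (μ⁻¹ • A x) := by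
      rw [map_smul]
      ext j
      · simp only [hΦA A lam μ hA hlam hAv hμ hAφ x, Prod.smul_fst, Pi.smul_apply, Pi.mul_apply,
          Pi.div_apply, smul_eq_mul]
        ring
      · simp only [Prod.smul_snd, hΦφ, hAφ, smul_eq_mul]
        field_simp
    rw [h1, Φ.injective.mem_set_image, Φ.injective.mem_set_image]
    constructor
    · intro hx
      exact hC.smul_mem _ (inv_pos.2 hμ) _ (hA ▸ mem_image_of_mem A hx)
    · intro hx
      have h2 := hC.smul_mem μ hμ _ hx
      rw [smul_inv_smul₀ hμ.ne'] at h2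
      nth_rewrite 1 [← hA] at h2
      rwa [A.injective.mem_set_image] at h2
  obtain ⟨j, hj⟩ := hne
  obtain ⟨ε, hε, hrigid⟩ := hFC.eq_zero_of_weakFlat (fun i => div_pos (hlam i) hμ) hinv (j := j)
    (fun h => hj ((div_eq_one_iff_eq hμ.ne').1 h))
  let X : (Fin d → V) → Matrix (Fin d) (Fin d) ℝ := fun y j k => (Φ (y j)).1 k
  let τ : (Fin d → V) → Fin d → ℝ := fun y j => (Φ (y j)).2
  have hΦc : Continuous Φ := Φ.toContinuousLinearEquiv.continuous
  have hXc : Continuous X := by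
    refine continuous_pi fun j => continuous_pi fun k => ?_
    exact (continuous_apply k).comp (continuous_fst.comp (hΦc.comp (continuous_apply j)))
  have hτc : Continuous τ := by
    refine continuous_pi fun j => ?_
    exact continuous_snd.comp (hΦc.comp (continuous_apply j))
  have hXv : X v = 1 := by
    ext i k
    simp [X, hΦv, axis, Matrix.one_apply, Pi.single_apply, eq_comm]
  have hτv : τ v = 0 := by
    ext i
    simp [τ, hΦv, axis]
  have hdet : ∀ᶠ y in nhds v, (X y).det ≠ 0 :=
    (hXc.matrix_det.continuousAt (x := v)).eventually_ne (by simp [hXv])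
  let G : (Fin d → V) → Fin d → ℝ := fun y => ((X y).det)⁻¹ • (X y).adjugate.mulVec (τ y)
  have hG : ContinuousAt G v := by
    refine ContinuousAt.smul (hXc.matrix_det.continuousAt.inv₀ (by simp [hXv])) ?_
    exact (hXc.matrix_adjugate.matrix_mulVec hτc).continuousAt
  have hGv : G v = 0 := by simp [G, hτv]
  have hGs : ∀ᶠ y in nhds v, ‖G y‖ < ε := by
    have h := hG.norm
    rw [ContinuousAt, hGv, norm_zero] at h
    exact h.eventually_lt_const hε
  obtain ⟨δ, hδ, hall⟩ := Metric.eventually_nhds_iff.1 (hdet.and hGs)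
  refine ⟨δ, hδ, fun v' hF' hy => ?_⟩
  choose y hyv hyd using hy
  obtain ⟨hdy, hGy⟩ := hall ((dist_pi_lt_iff hδ).2 hyd)
  have hXG : (X y).mulVec (G y) = τ y := by
    simp only [G]
    rw [Matrix.mulVec_smul, Matrix.mulVec_mulVec, Matrix.mul_adjugate, Matrix.smul_mulVec,
      Matrix.one_mulVec, smul_smul, inv_mul_cancel₀ hdy, one_smul]
  set L := G y with hL
  let ψ : V →ₗ[ℝ] ℝ := (LinearMap.snd ℝ (Fin d → ℝ) ℝ).comp Φ.toLinearMap -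
    ∑ k, L k • ((LinearMap.proj k).comp (LinearMap.fst ℝ (Fin d → ℝ) ℝ)).comp Φ.toLinearMap
  have hψ : ∀ z, ψ z = (Φ z).2 - L ⬝ᵥ (Φ z).1 := fun z => by
    simp [ψ, dotProduct, LinearMap.sum_apply]
  have hψy : ∀ j, ψ (y j) = 0 := fun j => by
    have := congrFun hXG j
    rw [hψ, dotProduct_comm, sub_eq_zero]
    exact this.symm
  have hψ0 : ψ ≠ 0 := fun h => by
    have h1 := hψ (Φ.symm (0, 1))
    rw [h] at h1
    simp at h1
  have hyind : LinearIndependent ℝ y := by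
    refine LinearIndependent.of_comp ((LinearMap.fst ℝ (Fin d → ℝ) ℝ).comp Φ.toLinearMap) ?_
    exact Matrix.linearIndependent_rows_iff_isUnit.2
      ((Matrix.isUnit_iff_isUnit_det _).2 (isUnit_iff_ne_zero.2 hdy))
  have hs : ∀ {u : Fin d → V}, LinearIndependent ℝ u →
      Module.finrank ℝ (Submodule.span ℝ (range u)) = d := fun hu => by
    simpa using finrank_span_eq_card hu
  have hspan : Submodule.span ℝ (range y) = Submodule.span ℝ (range v') :=
    Submodule.eq_of_le_of_finrank_eq
      (Submodule.span_le.2 (by rintro _ ⟨i, rfl⟩; exact hyv i))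
      ((hs hyind).trans (hs hF'.indep).symm)
  have hkerψ : LinearMap.ker ψ = Submodule.span ℝ (range v') := by
    have hk := Module.Dual.finrank_ker_add_one_of_ne_zero hψ0
    rw [← hspan]
    refine (Submodule.eq_of_le_of_finrank_eq (Submodule.span_le.2 ?_) ?_).symm
    · rintro _ ⟨i, rfl⟩
      exact hψy i
    · rw [hs hyind]; omega
  have hψv : ∀ i, ψ (v' i) = 0 := fun i => by
    rw [← LinearMap.mem_ker, hkerψ]
    exact Submodule.subset_span (mem_range_self i)
  have hweak : WeakFlat (Φ '' C) L := by
    refine hFC.weakFlat_of_vertices (fun i => Φ (v' i)) (fun i => ?_) (fun i h0 => ?_)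
      (fun i => ?_) (fun i j a b ha hb hmem => ?_) (fun z hz hzL => ?_)
    · exact map_mem_closure hΦc (hF'.mem_closure i) fun z hz => mem_image_of_mem Φ hz
    · exact hF'.indep.ne_zero i (Φ.map_eq_zero_iff.1 h0)
    · rw [← sub_eq_zero, ← hψ, hψv]
    · rw [← map_smul, ← map_smul, ← map_add, Φ.injective.mem_set_image] at hmem
      obtain ⟨k, hki, hkj⟩ : ∃ k, k ≠ i ∧ k ≠ j := by
        have hcard : ({i, j} : Finset (Fin d)).card < (Finset.univ : Finset (Fin d)).card :=
          Finset.card_le_two.trans_lt (by simp; omega)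
        obtain ⟨k, -, hk⟩ := Finset.exists_mem_notMem_of_card_lt_card hcard
        exact ⟨k, by simp_all⟩
      refine hF'.notMem (fun k => a * (Pi.single i 1 : Fin d → ℝ) k +
        b * (Pi.single j 1 : Fin d → ℝ) k) (fun k => ?_) ⟨k, by simp [hki, hkj]⟩ ?_
      · have h1 : ∀ l : Fin d, 0 ≤ (Pi.single l 1 : Fin d → ℝ) k := fun l => by
          rw [Pi.single_apply]; split_ifs <;> simp
        exact add_nonneg (mul_nonneg ha (h1 i)) (mul_nonneg hb (h1 j))
      · simpa only [add_smul, mul_smul, Finset.sum_add_distrib, ← Finset.smul_sum,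
          sum_single_smul] using hmem
    · obtain ⟨x, hx, rfl⟩ := hz
      have hxv : x ∈ Submodule.span ℝ (range v') := by
        rw [← hkerψ, LinearMap.mem_ker, hψ, hzL, sub_self]
      obtain ⟨c, hc, rfl⟩ := hF'.exists_pos_of_mem_span hC.convex hx hxv
      exact ⟨c, fun i => (hc i).le, by simp⟩
  have hL0 := hrigid L hweak hGy
  rw [← hkerψ, ← hker]
  congr 1
  ext z
  rw [hψ, hL0, zero_dotProduct, sub_zero, hΦφ]

/-- Some positive power of a linear automorphism preserving the cone and the span of a flat
fixes all vertex rays. -/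
lemma exists_pow_smul [FiniteDimensional ℝ V] [NeZero d] (hF : SimplexFlat C v)
    (hC : SharpCone C) (A : V ≃ₗ[ℝ] V) (hA : A '' C = C)
    (hAS : ∀ j, A (v j) ∈ Submodule.span ℝ (range v)) :
    ∃ (n : ℕ) (lam : Fin d → ℝ), n ≠ 0 ∧ (∀ j, 0 < lam j) ∧ ∀ j, (A ^ n) (v j) = lam j • v j := by
  have hmap : (Submodule.span ℝ (range v)).map A.toLinearMap = Submodule.span ℝ (range v) := by
    refine Submodule.eq_of_le_of_finrank_eq ?_ (LinearEquiv.finrank_map_eq A _)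
    rw [Submodule.map_span, Submodule.span_le]
    rintro _ ⟨_, ⟨j, rfl⟩, rfl⟩
    exact hAS j
  have hBS : ∀ j, A.symm (v j) ∈ Submodule.span ℝ (range v) := fun j => by
    have h : v j ∈ (Submodule.span ℝ (range v)).map A.toLinearMap := by
      rw [hmap]; exact Submodule.subset_span (mem_range_self j)
    obtain ⟨x, hx, hxv⟩ := h
    have : A.symm (v j) = x := by rw [← hxv]; simp
    rwa [this]
  have hB : A.symm '' C = C := by
    nth_rewrite 1 [← hA]
    rw [image_image]
    simp
  have hcoef : ∀ B : V ≃ₗ[ℝ] V, B '' C = C → (∀ j, B (v j) ∈ Submodule.span ℝ (range v)) →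
      ∃ m : Fin d → Fin d → ℝ, (∀ j k, 0 ≤ m j k) ∧ ∀ j, B (v j) = ∑ k, m j k • v k := by
    intro B hBC hBv
    choose m hm using fun j => (Submodule.mem_span_range_iff_exists_fun ℝ).1 (hBv j)
    refine ⟨m, fun j k => ?_, fun j => (hm j).symm⟩
    have hpos : ∀ n : ℕ, 0 ≤ m j k + 1 / ((n : ℝ) + 1) * ∑ i, m i k := by
      intro n
      have h1 : v j + (1 / ((n : ℝ) + 1)) • ∑ i, v i ∈ C := by
        rw [add_comm]
        exact hC.add_mem (hC.smul_mem _ (by positivity) _ hF.sum_mem) (hF.mem_closure j)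
      have h2 : B (v j + (1 / ((n : ℝ) + 1)) • ∑ i, v i) =
          ∑ k, (m j k + 1 / ((n : ℝ) + 1) * ∑ i, m i k) • v k := by
        rw [map_add, map_smul, map_sum]
        simp only [← hm, add_smul, Finset.sum_add_distrib, mul_smul, ← Finset.smul_sum,
          Finset.sum_smul]
        rw [Finset.sum_comm]
      have h3 : B (v j + (1 / ((n : ℝ) + 1)) • ∑ i, v i) ∈ C := hBC ▸ mem_image_of_mem B h1
      obtain ⟨c, hc, hcz⟩ := hF.exists_pos_of_mem_span hC.convex h3 (by
        rw [h2]
        exact Submodule.sum_mem _ fun k _ =>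
          Submodule.smul_mem _ _ (Submodule.subset_span (mem_range_self k)))
      rw [h2] at hcz
      have h4 := Fintype.linearIndependent_iff.1 hF.indep
        (fun k => m j k + 1 / ((n : ℝ) + 1) * ∑ i, m i k - c k) (by
          simp only [sub_smul, Finset.sum_sub_distrib]
          rw [hcz, sub_self]) k
      have := hc k
      linarith
    have hlim : Tendsto (fun n : ℕ => m j k + 1 / ((n : ℝ) + 1) * ∑ i, m i k) atTop
        (nhds (m j k)) := by
      simpa using ((tendsto_one_div_add_atTop_nhds_zero_nat (𝕜 := ℝ)).mul_const
        (∑ i, m i k)).const_add (m j k)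
    exact ge_of_tendsto hlim (Eventually.of_forall hpos)
  obtain ⟨m, hm0, hm⟩ := hcoef A hA hAS
  obtain ⟨n, hn0, hn⟩ := hcoef A.symm hB hBS
  have hperm : ∀ j, ∃ k, ∃ c : ℝ, 0 < c ∧ A (v j) = c • v k := by
    intro j
    obtain ⟨k, hk⟩ : ∃ k, 0 < m j k := by
      by_contra! h
      have h0 : ∀ k, m j k = 0 := fun k => le_antisymm (h k) (hm0 j k)
      have := hm j
      simp only [h0, zero_smul, Finset.sum_const_zero] at this
      exact hF.indep.ne_zero j (A.map_eq_zero_iff.1 this)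
    have h1 : ∑ i, ((∑ k, m j k * n k i) - (Pi.single j 1 : Fin d → ℝ) i) • v i = 0 := by
      simp only [sub_smul, Finset.sum_sub_distrib, sum_single_smul, Finset.sum_smul, mul_smul]
      rw [Finset.sum_comm]
      simp only [← Finset.smul_sum, ← hn]
      rw [sub_eq_zero]
      apply A.injective
      rw [map_sum, hm]
      simp
    have h2 : ∀ i, i ≠ j → n k i = 0 := by
      intro i hi
      have h3 := Fintype.linearIndependent_iff.1 hF.indep _ h1 i
      rw [Pi.single_eq_of_ne hi, sub_zero] at h3
      have h4 := (Finset.sum_eq_zero_iff_of_nonneg fun k _ =>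
        mul_nonneg (hm0 j k) (hn0 k i)).1 h3 k (Finset.mem_univ k)
      exact (mul_eq_zero.1 h4).resolve_left hk.ne'
    have h3 : A.symm (v k) = n k j • v j := by
      rw [hn]
      exact Finset.sum_eq_single j (fun i _ hi => by rw [h2 i hi, zero_smul]) (by simp)
    have h4 : n k j ≠ 0 := fun h => by
      rw [h, zero_smul] at h3
      exact hF.indep.ne_zero k (A.symm.map_eq_zero_iff.1 h3)
    refine ⟨k, (n k j)⁻¹, inv_pos.2 ((hn0 k j).lt_of_ne' h4), ?_⟩
    rw [LinearEquiv.symm_apply_eq, map_smul] at h3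
    rw [h3, inv_smul_smul₀ h4]
  choose σ c hc hσ using hperm
  have hσinj : Function.Injective σ := by
    intro j j' hjj
    by_contra hne
    have h1 : A (c j' • v j - c j • v j') = 0 := by
      rw [map_sub, map_smul, map_smul, hσ, hσ, hjj, smul_smul, smul_smul, mul_comm, sub_self]
    rw [A.map_eq_zero_iff] at h1
    have h2 := Fintype.linearIndependent_iff.1 hF.indep
      (fun i => c j' * (Pi.single j 1 : Fin d → ℝ) i - c j * (Pi.single j' 1 : Fin d → ℝ) i) (by
        simpa only [sub_smul, mul_smul, Finset.sum_sub_distrib, ← Finset.smul_sum,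
          sum_single_smul] using h1) j
    simp [Pi.single_eq_of_ne hne, (hc j').ne'] at h2
  let s : Equiv.Perm (Fin d) := Equiv.ofBijective σ (Finite.injective_iff_bijective.1 hσinj)
  have hpow : ∀ N : ℕ, ∀ j, ∃ b : ℝ, 0 < b ∧ (A ^ N) (v j) = b • v ((s ^ N) j) := by
    intro N
    induction N with
    | zero => exact fun j => ⟨1, one_pos, by simp⟩
    | succ N ih =>
      intro j
      obtain ⟨b, hb, hbv⟩ := ih j
      refine ⟨b * c ((s ^ N) j), mul_pos hb (hc _), ?_⟩
      rw [pow_succ', LinearEquiv.mul_apply, hbv, map_smul, hσ, smul_smul, pow_succ',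
        Equiv.Perm.mul_apply]
      rfl
  choose b hb hbv using hpow (orderOf s)
  refine ⟨orderOf s, b, (orderOf_pos s).ne', hb, fun j => ?_⟩
  rw [hbv, pow_orderOf_eq_one, Equiv.Perm.one_apply]

end SimplexFlat

end SimplexFlats

section Domains

variable {d : ℕ} {Ω : Set (Euc d)} {v : Fin d → Euc d}

lemma mem_coneOver {p : Euc d × ℝ} : p ∈ coneOver Ω ↔ 0 < p.2 ∧ p.2⁻¹ • p.1 ∈ Ω := by
  constructor
  · rintro ⟨t, ht, x, hx, rfl⟩
    simpa [ht, inv_smul_smul₀ ht.ne'] using hx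
  · rintro ⟨ht, hx⟩
    refine ⟨p.2, ht, _, hx, ?_⟩
    ext1
    · simp [smul_inv_smul₀ ht.ne']
    · simp

lemma mk_one_mem_coneOver {x : Euc d} : (x, (1 : ℝ)) ∈ coneOver Ω ↔ x ∈ Ω := by
  simp [mem_coneOver]

lemma sharpCone_coneOver (hne : Ω.Nonempty) (hbd : Bornology.IsBounded Ω) (hop : IsOpen Ω)
    (hconv : Convex ℝ Ω) : SharpCone (coneOver Ω) := by
  obtain ⟨R, hR⟩ := hbd.exists_norm_le
  have hcl : ∀ z ∈ closure (coneOver Ω), 0 ≤ z.2 ∧ ‖z.1‖ ≤ R * z.2 := by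
    refine fun z hz => closure_minimal (t := {z : Euc d × ℝ | 0 ≤ z.2 ∧ ‖z.1‖ ≤ R * z.2}) ?_
      ((isClosed_le continuous_const continuous_snd).inter
        (isClosed_le continuous_fst.norm (continuous_snd.const_mul R))) hz
    rintro _ ⟨t, ht, x, hx, rfl⟩
    refine ⟨by simpa using ht.le, ?_⟩
    simp only [Prod.smul_fst, Prod.smul_snd, norm_smul, Real.norm_of_nonneg ht.le, smul_eq_mul,
      mul_one]
    rw [mul_comm]
    exact mul_le_mul_of_nonneg_right (hR x hx) ht.le
  refine ⟨?_, ?_, ?_, ?_, ?_⟩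
  · have h : coneOver Ω = {p : Euc d × ℝ | 0 < p.2} ∩ (fun p => p.2⁻¹ • p.1) ⁻¹' Ω := by
      ext p; exact mem_coneOver
    rw [h]
    refine ContinuousOn.isOpen_inter_preimage (fun p hp => ?_)
      (isOpen_lt continuous_const continuous_snd) hop
    exact ((continuous_snd.continuousAt.inv₀ (ne_of_gt hp)).smul
      continuous_fst.continuousAt).continuousWithinAt
  · refine (convex_iff_forall_pos).2 ?_
    rintro _ ⟨t, ht, x, hx, rfl⟩ _ ⟨s, hs, y, hy, rfl⟩ a b ha hb -
    have h0 : 0 < a * t + b * s := by positivity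
    refine ⟨a * t + b * s, h0, (a * t / (a * t + b * s)) • x + (b * s / (a * t + b * s)) • y,
      hconv hx hy (by positivity) (by positivity) (by field_simp), ?_⟩
    ext1
    · simp only [Prod.fst_add, Prod.smul_fst, smul_add, smul_smul, mul_div_cancel₀ _ h0.ne']
    · simp
  · rintro t ht _ ⟨s, hs, x, hx, rfl⟩
    exact ⟨t * s, mul_pos ht hs, x, hx, smul_smul _ _ _⟩
  · obtain ⟨x, hx⟩ := hne
    exact ⟨_, mk_one_mem_coneOver.2 hx⟩
  · intro z hz hz'
    have h1 := hcl z hz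
    have h2 := (hcl _ hz').1
    rw [Prod.snd_neg] at h2
    have h3 : z.2 = 0 := by linarith [h1.1]
    have h4 := h1.2
    rw [h3, mul_zero] at h4
    exact Prod.ext (norm_le_zero_iff.1 h4) h3

lemma apply_mk_one {g : (Euc d × ℝ) ≃ₗ[ℝ] (Euc d × ℝ)} {x : Euc d} (h : (g (x, 1)).2 ≠ 0) :
    g (x, 1) = (g (x, 1)).2 • (projAct g x, (1 : ℝ)) := by
  ext1
  · simp [projAct, smul_inv_smul₀ h]
  · simp

lemma snd_apply_pos {g : (Euc d × ℝ) ≃ₗ[ℝ] (Euc d × ℝ)} (hg : g '' coneOver Ω = coneOver Ω)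
    {x : Euc d} (hx : x ∈ Ω) : 0 < (g (x, 1)).2 :=
  (mem_coneOver.1 (hg ▸ mem_image_of_mem g (mk_one_mem_coneOver.2 hx))).1

lemma Divides.cocompactCone {Γ : Subgroup ((Euc d × ℝ) ≃ₗ[ℝ] (Euc d × ℝ))}
    (h : Divides Ω Γ) (hC : SharpCone (coneOver Ω)) : CocompactCone (coneOver Ω) := by
  obtain ⟨hΓ, -, -, K, hKΩ, hK, hcov⟩ := h
  refine ⟨(fun x => (x, (1 : ℝ))) '' K, ?_, hK.image (by fun_prop), ?_⟩
  · rintro _ ⟨x, hx, rfl⟩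
    exact mk_one_mem_coneOver.2 (hKΩ hx)
  rintro _ ⟨t, ht, x, hx, rfl⟩
  rw [← hcov] at hx
  simp only [mem_iUnion] at hx
  obtain ⟨γ, hγ, y, hy, rfl⟩ := hx
  have hs := snd_apply_pos (hΓ γ hγ) (hKΩ hy)
  have hγy := apply_mk_one hs.ne'
  set s := (γ (y, 1)).2
  have hst : 0 < s / t := div_pos hs ht
  refine ⟨γ.symm.trans (LinearEquiv.smulOfNeZero ℝ _ (s / t) hst.ne'), ?_, y, hy, ?_⟩
  · have h1 : γ.symm '' coneOver Ω = coneOver Ω := by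
      nth_rewrite 1 [← hΓ γ hγ]
      rw [image_image]
      simp
    have h2 : (fun z : Euc d × ℝ => (s / t) • z) '' coneOver Ω = coneOver Ω := by
      refine Subset.antisymm ?_ fun z hz => ⟨(s / t)⁻¹ • z, hC.smul_mem _ (inv_pos.2 hst) _ hz,
        smul_inv_smul₀ hst.ne' z⟩
      rintro _ ⟨z, hz, rfl⟩
      exact hC.smul_mem _ hst _ hz
    nth_rewrite 2 [← h2]
    nth_rewrite 2 [← h1]
    rw [image_image]
    rfl
  · change (y, (1 : ℝ)) = (s / t) • γ.symm (t • (projAct γ y, (1 : ℝ)))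
    rw [← map_smul, smul_smul, div_mul_cancel₀ _ ht.ne', ← hγy, LinearEquiv.symm_apply_apply]

lemma linearIndependent_mk_one (hv : AffineIndependent ℝ v) :
    LinearIndependent ℝ (fun j => (v j, (1 : ℝ))) := by
  rw [Fintype.linearIndependent_iff]
  intro c hc i
  have h1 := congrArg Prod.fst hc
  have h2 := congrArg Prod.snd hc
  simp only [Prod.fst_sum, Prod.snd_sum, Prod.smul_fst, Prod.smul_snd, smul_eq_mul, mul_one,
    Prod.fst_zero, Prod.snd_zero] at h1 h2
  exact affineIndependent_iff.1 hv Finset.univ c h2 h1 i (Finset.mem_univ i)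

/-- The affine map `x ↦ (x, 1)`. -/
def mkOne (d : ℕ) : Euc d →ᵃ[ℝ] Euc d × ℝ :=
  (AffineMap.id ℝ (Euc d)).prod (AffineMap.const ℝ (Euc d) 1)

lemma mk_one_mem_span {x : Euc d} (hx : x ∈ affineSpan ℝ (range v)) :
    (x, (1 : ℝ)) ∈ Submodule.span ℝ (range fun j => (v j, (1 : ℝ))) := by
  have h : affineSpan ℝ (range v) ≤
      ((Submodule.span ℝ (range fun j => (v j, (1 : ℝ)))).toAffineSubspace).comap (mkOne d) := by
    rw [affineSpan_le]
    rintro _ ⟨j, rfl⟩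
    exact Submodule.subset_span ⟨j, rfl⟩
  exact h hx

lemma sum_smul_mem_convexHull {c : Fin d → ℝ} (hc : ∀ j, 0 ≤ c j) (h1 : ∑ j, c j = 1) :
    ∑ j, c j • v j ∈ convexHull ℝ (range v) :=
  (convex_convexHull ℝ _).sum_mem (fun j _ => hc j) h1
    fun j _ => subset_convexHull ℝ _ (mem_range_self j)

lemma sum_smul_mk_one (c : Fin d → ℝ) :
    ∑ j, c j • (v j, (1 : ℝ)) = (∑ j, c j • v j, ∑ j, c j) := by
  ext1
  · simp [Prod.fst_sum]
  · simp [Prod.snd_sum]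

/-- Barycentric coordinates with respect to `v`, extended to continuous affine functions. -/
lemma exists_barycentric (hv : AffineIndependent ℝ v) :
    ∃ g : Fin d → Euc d →ᴬ[ℝ] ℝ,
      (∀ c : Fin d → ℝ, ∑ j, c j = 1 → ∀ i, g i (∑ j, c j • v j) = c i) ∧
      ∀ x ∈ affineSpan ℝ (range v), ∑ j, g j x = 1 ∧ x = ∑ j, g j x • v j := by
  have hli := linearIndependent_mk_one hv
  obtain ⟨h, hh⟩ := LinearMap.exists_leftInverse_of_injective
    (Fintype.linearCombination ℝ (fun j => (v j, (1 : ℝ)))) (by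
      rw [LinearMap.ker_eq_bot, ← linearIndependent_iff_injective_fintypeLinearCombination]; exact hli)
  have hinv : ∀ c : Fin d → ℝ, h (∑ j, c j • (v j, (1 : ℝ))) = c := fun c => by
    have := LinearMap.congr_fun hh c
    simpa [Fintype.linearCombination_apply] using this
  let g : Fin d → Euc d →ᴬ[ℝ] ℝ := fun i =>
    ⟨((LinearMap.proj i).comp h).toAffineMap.comp (mkOne d),
      AffineMap.continuous_of_finiteDimensional _⟩
  have hg : ∀ i x, g i x = h (x, 1) i := fun i x => rfl
  refine ⟨g, fun c hc i => ?_, fun x hx => ?_⟩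
  · rw [hg, ← hc, ← sum_smul_mk_one, hinv]
  · obtain ⟨c, hc⟩ := (Submodule.mem_span_range_iff_exists_fun ℝ).1 (mk_one_mem_span hx)
    have hgc : ∀ j, g j x = c j := fun j => by rw [hg, ← hc, hinv]
    rw [sum_smul_mk_one, Prod.mk.injEq] at hc
    simp only [hgc]
    exact ⟨hc.2, hc.1.symm⟩

lemma sum_smul_mem_intrinsicInterior (hv : AffineIndependent ℝ v) {c : Fin d → ℝ}
    (hc : ∀ j, 0 < c j) (h1 : ∑ j, c j = 1) :
    ∑ j, c j • v j ∈ intrinsicInterior ℝ (convexHull ℝ (range v)) := by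
  obtain ⟨g, hg, hgs⟩ := exists_barycentric hv
  have hmem := sum_smul_mem_convexHull (v := v) (fun j => (hc j).le) h1
  rw [mem_intrinsicInterior]
  let S := affineSpan ℝ (convexHull ℝ (range v))
  refine ⟨⟨_, subset_affineSpan ℝ _ hmem⟩, ?_, rfl⟩
  have hopen : IsOpen {y : S | ∀ j, 0 < g j y} := by
    simp only [ofPred_forall]
    exact isOpen_iInter_of_finite fun j =>
      isOpen_lt continuous_const ((g j).continuous.comp continuous_subtype_val)
  refine interior_maximal ?_ hopen fun j => ?_
  · intro y hy
    have hyS : (y : Euc d) ∈ affineSpan ℝ (range v) := by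
      rw [← affineSpan_convexHull]; exact y.2
    obtain ⟨hy1, hy2⟩ := hgs y hyS
    rw [mem_preimage, hy2]
    exact sum_smul_mem_convexHull (fun j => (hy j).le) hy1
  · change 0 < g j (∑ j, c j • v j)
    rw [hg c h1]
    exact hc j

lemma sum_smul_notMem_intrinsicInterior (hv : AffineIndependent ℝ v) {c : Fin d → ℝ}
    (h1 : ∑ j, c j = 1) {j : Fin d} (hj : c j = 0) :
    ∑ j, c j • v j ∉ intrinsicInterior ℝ (convexHull ℝ (range v)) := by
  obtain ⟨g, hg, hgs⟩ := exists_barycentric hv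
  intro hmem
  rw [mem_intrinsicInterior] at hmem
  obtain ⟨x, hx, hxc⟩ := hmem
  have hgx : g j x = 0 := by rw [hxc, hg c h1, hj]
  have hgv : ∀ i, g j (v i) = if i = j then 1 else 0 := fun i => by
    have := hg (Pi.single i 1) (by simp) j
    rw [sum_single_smul] at this
    rw [this, Pi.single_apply]
    simp [eq_comm]
  have hvS : v j ∈ affineSpan ℝ (convexHull ℝ (range v)) :=
    subset_affineSpan ℝ _ (subset_convexHull ℝ _ (mem_range_self j))
  let p : ℝ → affineSpan ℝ (convexHull ℝ (range v)) := fun t =>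
    ⟨AffineMap.lineMap (x : Euc d) (v j) t, AffineMap.lineMap_mem t x.2 hvS⟩
  have hp : Continuous p := by
    refine Continuous.subtype_mk ?_ _
    exact AffineMap.lineMap_continuous
  have hp0 : p 0 = x := Subtype.ext (AffineMap.lineMap_apply_zero _ _)
  have hev : ∀ᶠ t in nhds (0 : ℝ), (p t : Euc d) ∈ convexHull ℝ (range v) := by
    have h := hp.tendsto 0
    rw [hp0] at h
    exact (h.eventually_mem (isOpen_interior.mem_nhds hx)).mono fun t ht =>
      interior_subset (s := Subtype.val ⁻¹' convexHull ℝ (range v)) ht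
  have hlim : Tendsto (fun n : ℕ => -(1 / ((n : ℝ) + 1))) atTop (nhds 0) := by
    simpa using (tendsto_one_div_add_atTop_nhds_zero_nat (𝕜 := ℝ)).neg
  obtain ⟨n, hn⟩ := (hlim.eventually hev).exists
  have hnonneg : ∀ y ∈ convexHull ℝ (range v), 0 ≤ g j y := by
    refine fun y hy => convexHull_min (t := {y | 0 ≤ g j y}) ?_ ?_ hy
    · rintro _ ⟨i, rfl⟩
      rw [mem_ofPred_eq, hgv]
      split_ifs <;> simp
    · exact (convex_Ici (0 : ℝ)).affine_preimage (g j : Euc d →ᵃ[ℝ] ℝ)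
  have h2 := hnonneg _ hn
  have h3 : g j (p (-(1 / ((n : ℝ) + 1)))) = -(1 / ((n : ℝ) + 1)) := by
    have : g j (AffineMap.lineMap (x : Euc d) (v j) (-(1 / ((n : ℝ) + 1)))) =
      AffineMap.lineMap (g j x) (g j (v j)) (-(1 / ((n : ℝ) + 1))) :=
      (g j : Euc d →ᵃ[ℝ] ℝ).apply_lineMap _ _ _
    refine this.trans ?_
    rw [hgx, hgv, if_pos rfl]
    simp [AffineMap.lineMap_apply]
  rw [h3] at h2
  have : (0 : ℝ) < 1 / ((n : ℝ) + 1) := by positivity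
  linarith

namespace IsFlatWith

lemma simplexFlat [NeZero d] (h : IsFlatWith Ω v) :
    SimplexFlat (coneOver Ω) (fun j => (v j, (1 : ℝ))) := by
  obtain ⟨hv, -, hsub, hbdry⟩ := h
  have hnorm : ∀ c : Fin d → ℝ, 0 < ∑ j, c j → ∑ j, (∑ i, c i)⁻¹ * c j = 1 := fun c hc => by
    rw [← Finset.mul_sum, inv_mul_cancel₀ hc.ne']
  have hsmul : ∀ c : Fin d → ℝ,
      (∑ i, c i)⁻¹ • ∑ j, c j • v j = ∑ j, ((∑ i, c i)⁻¹ * c j) • v j := fun c => by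
    simp only [Finset.smul_sum, smul_smul]
  refine ⟨linearIndependent_mk_one hv, fun c hc => ?_, fun c hc hj hmem => ?_⟩
  · have hpos : 0 < ∑ j, c j := Finset.sum_pos (fun j _ => hc j) Finset.univ_nonempty
    rw [sum_smul_mk_one, mem_coneOver]
    refine ⟨hpos, hsub ?_⟩
    rw [hsmul]
    exact sum_smul_mem_intrinsicInterior hv (fun j => mul_pos (inv_pos.2 hpos) (hc j)) (hnorm c hpos)
  · obtain ⟨j, hj⟩ := hj
    rw [sum_smul_mk_one, mem_coneOver] at hmem
    obtain ⟨hpos, hmem⟩ := hmem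
    rw [hsmul] at hmem
    refine (hbdry ⟨sum_smul_mem_convexHull (fun j => mul_nonneg (inv_pos.2 hpos).le (hc j))
      (hnorm c hpos), sum_smul_notMem_intrinsicInterior hv (hnorm c hpos) (j := j) ?_⟩).2 hmem
    rw [hj, mul_zero]

lemma mem_iff [NeZero d] (h : IsFlatWith Ω v) (hne : Ω.Nonempty) (hbd : Bornology.IsBounded Ω)
    (hop : IsOpen Ω) (hconv : Convex ℝ Ω) {x : Euc d} :
    x ∈ intrinsicInterior ℝ (convexHull ℝ (range v)) ↔
      x ∈ Ω ∧ (x, (1 : ℝ)) ∈ Submodule.span ℝ (range fun j => (v j, (1 : ℝ))) := by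
  constructor
  · exact fun hx => ⟨h.2.2.1 hx, mk_one_mem_span (convexHull_subset_affineSpan _
      (intrinsicInterior_subset hx))⟩
  · rintro ⟨hx, hxs⟩
    obtain ⟨c, hc, hxc⟩ := h.simplexFlat.exists_pos_of_mem_span
      (sharpCone_coneOver hne hbd hop hconv).convex (mk_one_mem_coneOver.2 hx) hxs
    rw [sum_smul_mk_one, Prod.mk.injEq] at hxc
    rw [hxc.1]
    exact sum_smul_mem_intrinsicInterior h.1 hc hxc.2.symm

lemma closure_subset :
    closure (intrinsicInterior ℝ (convexHull ℝ (range v))) ⊆ convexHull ℝ (range v) :=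
  closure_minimal intrinsicInterior_subset ((finite_range v).isClosed_convexHull ℝ)

lemma nonempty [NeZero d] (h : IsFlatWith Ω v) :
    (intrinsicInterior ℝ (convexHull ℝ (range v))).Nonempty := by
  refine ⟨_, sum_smul_mem_intrinsicInterior h.1 (c := fun _ => (d : ℝ)⁻¹) (fun j => ?_) ?_⟩
  · have := NeZero.pos d
    positivity
  · simp

lemma vertex_mem_closure [NeZero d] (h : IsFlatWith Ω v) (j : Fin d) :
    v j ∈ closure (intrinsicInterior ℝ (convexHull ℝ (range v))) := by
  have hd : (0 : ℝ) < d := by exact_mod_cast NeZero.pos d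
  let p : ℝ → Euc d := fun t =>
    ∑ i, ((1 - t) * Pi.single (M := fun _ => ℝ) j 1 i + t * (d : ℝ)⁻¹) • v i
  have hp : Continuous p := by fun_prop
  have hlim : Tendsto (fun n : ℕ => p (1 / ((n : ℝ) + 1))) atTop (nhds (v j)) := by
    have h0 : p 0 = v j := by
      simp only [p, sub_zero, one_mul, zero_mul, add_zero]
      exact sum_single_smul _ _
    rw [← h0]
    exact (hp.tendsto 0).comp tendsto_one_div_add_atTop_nhds_zero_nat
  refine mem_closure_of_tendsto hlim (Eventually.of_forall fun n => ?_)
  have hn : (0 : ℝ) < 1 / ((n : ℝ) + 1) := by positivity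
  have hn1 : 1 / ((n : ℝ) + 1) ≤ 1 := by
    rw [div_le_one (by positivity)]
    linarith [n.cast_nonneg (α := ℝ)]
  refine sum_smul_mem_intrinsicInterior h.1 (fun i => ?_) ?_
  · have : (0 : ℝ) ≤ Pi.single (M := fun _ => ℝ) j 1 i := by
      rw [Pi.single_apply]; split_ifs <;> norm_num
    have h1 := mul_nonneg (sub_nonneg.2 hn1) this
    have h2 := mul_pos hn (inv_pos.2 hd)
    linarith
  · rw [Finset.sum_add_distrib, ← Finset.mul_sum, Finset.sum_pi_single' j]
    simp only [Finset.mem_univ, if_true, Finset.sum_const, Finset.card_univ, Fintype.card_fin,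
      nsmul_eq_mul]
    field_simp
    ring

end IsFlatWith

end Domains

lemma exists_eigen_functional {V : Type*} [AddCommGroup V] [Module ℝ V] {S : Submodule ℝ V}
    {φ : V →ₗ[ℝ] ℝ} (hφ : φ ≠ 0) (hker : LinearMap.ker φ = S) (A : V ≃ₗ[ℝ] V)
    (hA : ∀ z ∈ S, A z ∈ S) : ∃ μ : ℝ, μ ≠ 0 ∧ ∀ z, φ (A z) = μ * φ z := by
  obtain ⟨u, hu⟩ := LinearMap.surjective hφ 1
  have h : ∀ z, φ (A z) = φ (A u) * φ z := fun z => by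
    have h1 : z - φ z • u ∈ S := by
      rw [← hker, LinearMap.mem_ker]
      simp [hu]
    have h2 := hA _ h1
    rw [← hker, LinearMap.mem_ker] at h2
    simp only [map_sub, map_smul, smul_eq_mul] at h2
    linarith
  refine ⟨φ (A u), fun h0 => ?_, h⟩
  have h1 := h (A.symm u)
  rw [LinearEquiv.apply_symm_apply, hu, h0, zero_mul] at h1
  exact one_ne_zero h1

namespace IsFlatWith

variable {d : ℕ} {Ω : Set (Euc d)} {v : Fin d → Euc d}

lemma apply_mem_span [NeZero d] (h : IsFlatWith Ω v) (hne : Ω.Nonempty)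
    (hbd : Bornology.IsBounded Ω) (hop : IsOpen Ω) (hconv : Convex ℝ Ω)
    {γ : (Euc d × ℝ) ≃ₗ[ℝ] (Euc d × ℝ)} (hγ : γ '' coneOver Ω = coneOver Ω)
    (hF : projAct γ '' intrinsicInterior ℝ (convexHull ℝ (range v)) =
      intrinsicInterior ℝ (convexHull ℝ (range v))) (j : Fin d) :
    γ (v j, 1) ∈ Submodule.span ℝ (range fun j => (v j, (1 : ℝ))) := by
  have hC := sharpCone_coneOver hne hbd hop hconv
  have hmem : ∀ z ∈ coneOver Ω, z ∈ Submodule.span ℝ (range fun j => (v j, (1 : ℝ))) →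
      γ z ∈ Submodule.span ℝ (range fun j => (v j, (1 : ℝ))) := by
    rintro _ ⟨t, ht, x, hx, rfl⟩ hxS
    have hxF := (h.mem_iff hne hbd hop hconv).2
      ⟨hx, (Submodule.smul_mem_iff _ ht.ne').1 hxS⟩
    have hγx : projAct γ x ∈ intrinsicInterior ℝ (convexHull ℝ (range v)) :=
      hF ▸ mem_image_of_mem _ hxF
    rw [map_smul, apply_mk_one (snd_apply_pos hγ hx).ne']
    exact Submodule.smul_mem _ _ (Submodule.smul_mem _ _
      ((h.mem_iff hne hbd hop hconv).1 hγx).2)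
  have hSF := h.simplexFlat
  have hsum : ∑ i, (v i, (1 : ℝ)) ∈ Submodule.span ℝ (range fun j => (v j, (1 : ℝ))) :=
    Submodule.sum_mem _ fun i _ => Submodule.subset_span (mem_range_self i)
  have h1 := hmem _ hSF.sum_mem hsum
  have h2 := hmem _ (hC.add_mem hSF.sum_mem (hSF.mem_closure j))
    (Submodule.add_mem _ hsum (Submodule.subset_span (mem_range_self j)))
  rw [map_add] at h2
  exact (Submodule.add_mem_iff_right _ h1).1 h2

lemma eq_of_span_eq [NeZero d] {v' : Fin d → Euc d} (h : IsFlatWith Ω v) (h' : IsFlatWith Ω v')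
    (hne : Ω.Nonempty) (hbd : Bornology.IsBounded Ω) (hop : IsOpen Ω) (hconv : Convex ℝ Ω)
    (hspan : Submodule.span ℝ (range fun j => (v' j, (1 : ℝ))) =
      Submodule.span ℝ (range fun j => (v j, (1 : ℝ)))) :
    intrinsicInterior ℝ (convexHull ℝ (range v')) =
      intrinsicInterior ℝ (convexHull ℝ (range v)) := by
  ext x
  rw [h.mem_iff hne hbd hop hconv, h'.mem_iff hne hbd hop hconv, hspan]

/-- Flats whose span comes close to the vertices of a flat with infinite stabilizer have the same
span as that flat. -/
lemma exists_rigid (h : IsFlatWith Ω v) (hne : Ω.Nonempty) (hbd : Bornology.IsBounded Ω)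
    (hop : IsOpen Ω) (hconv : Convex ℝ Ω) (hd : 3 ≤ d) (hirr : IsIrreducibleDomain Ω)
    {Γ : Subgroup ((Euc d × ℝ) ≃ₗ[ℝ] (Euc d × ℝ))} (htf : TorsionFreeSub Γ) (hdiv : Divides Ω Γ)
    {γ : (Euc d × ℝ) ≃ₗ[ℝ] (Euc d × ℝ)} (hγ : γ ∈ Γ) (hγ1 : γ ≠ 1)
    (hF : projAct γ '' intrinsicInterior ℝ (convexHull ℝ (range v)) =
      intrinsicInterior ℝ (convexHull ℝ (range v))) :
    ∃ δ : ℝ, 0 < δ ∧ ∀ v' : Fin d → Euc d × ℝ, SimplexFlat (coneOver Ω) v' →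
      (∀ j, ∃ y ∈ Submodule.span ℝ (range v'), dist y (v j, (1 : ℝ)) < δ) →
      Submodule.span ℝ (range v') = Submodule.span ℝ (range fun j => (v j, (1 : ℝ))) := by
  have : NeZero d := ⟨by omega⟩
  have hC := sharpCone_coneOver hne hbd hop hconv
  have hSF := h.simplexFlat
  have hdim : Module.finrank ℝ (Euc d × ℝ) = d + 1 := by simp
  obtain ⟨φ, hφ, hker⟩ := hSF.exists_ker_eq_span hdim
  have hAS := h.apply_mem_span hne hbd hop hconv (hdiv.1 γ hγ) hF
  obtain ⟨n, lam, hn, hlam, hAv⟩ := hSF.exists_pow_smul hC γ (hdiv.1 γ hγ) hAS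
  obtain ⟨μ, hμ, hAφ⟩ := exists_eigen_functional hφ hker (γ ^ n) fun z hz => by
    have hle : Submodule.span ℝ (range fun j => (v j, (1 : ℝ))) ≤
        (Submodule.span ℝ (range fun j => (v j, (1 : ℝ)))).comap (γ ^ n).toLinearMap := by
      rw [Submodule.span_le]
      rintro _ ⟨j, rfl⟩
      change (γ ^ n) (v j, 1) ∈ Submodule.span ℝ (range fun j => (v j, (1 : ℝ)))
      rw [hAv]
      exact Submodule.smul_mem _ _ (Submodule.subset_span (mem_range_self j))
    exact hle hz
  have hB : ∀ z, (γ ^ (n * 2)) z = (γ ^ n) ((γ ^ n) z) := fun z => by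
    rw [pow_mul, sq]; rfl
  have hBΓ : γ ^ (n * 2) ∈ Γ := pow_mem hγ _
  have hBv : ∀ j, (γ ^ (n * 2)) (v j, 1) = (lam j * lam j) • (v j, (1 : ℝ)) := fun j => by
    rw [hB, hAv, map_smul, hAv, smul_smul]
  refine hSF.exists_rigid hd hC (hdiv.cocompactCone hC) hirr hdim hφ hker (γ ^ (n * 2))
    (fun j => lam j * lam j) (μ * μ) (hdiv.1 _ hBΓ) (fun j => mul_pos (hlam j) (hlam j)) hBv
    (mul_self_pos.2 hμ) (fun z => by rw [hB, hAφ, hAφ, mul_assoc]) ?_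
  by_contra! hall
  have hB1 : γ ^ (n * 2) ≠ 1 := fun h1 => hγ1 (htf γ hγ _ (by omega) h1)
  obtain ⟨x, hx⟩ := h.nonempty
  obtain ⟨hxΩ, hxS⟩ := (h.mem_iff hne hbd hop hconv).1 hx
  obtain ⟨c, hc⟩ := (Submodule.mem_span_range_iff_exists_fun ℝ).1 hxS
  have hBx : (γ ^ (n * 2)) (x, 1) = (μ * μ) • (x, (1 : ℝ)) := by
    rw [← hc, map_sum, Finset.smul_sum]
    refine Finset.sum_congr rfl fun j _ => ?_
    rw [map_smul, hBv, hall, smul_comm]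
  refine hdiv.2.1 _ hBΓ hB1 x hxΩ ?_
  have hμ' := mul_self_ne_zero.2 hμ
  rw [projAct, hBx]
  simp only [Prod.smul_fst, Prod.smul_snd, smul_eq_mul, mul_one, inv_smul_smul₀ hμ']

end IsFlatWith

theorem infinite_stabilizer_implies_isolated {d : ℕ} (Ω : Set (Euc d)) (hne : Ω.Nonempty)
    (hbd : Bornology.IsBounded Ω) (hop : IsOpen Ω) (hconv : Convex ℝ Ω)
    (hd : 3 ≤ d) (hirr : IsIrreducibleDomain Ω)
    (Γ : Subgroup ((Euc d × ℝ) ≃ₗ[ℝ] (Euc d × ℝ)))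
    (htf : TorsionFreeSub Γ) (hdiv : Divides Ω Γ)
    (F : Set (Euc d)) (hF : IsFlat Ω F)
    (hstab : {γ : (Euc d × ℝ) ≃ₗ[ℝ] (Euc d × ℝ) | γ ∈ Γ ∧ projAct γ '' F = F}.Infinite) :
    IsIsolatedFlat Ω F := by
  have : NeZero d := ⟨by omega⟩
  rintro ⟨Fs, hFs, hFne, hlim⟩
  obtain ⟨v, hv, rfl⟩ := hF
  obtain ⟨γ, ⟨hγ, hγF⟩, hγ1⟩ := hstab.exists_notMem_finite (finite_singleton 1)
  obtain ⟨δ, hδ, hrigid⟩ := hv.exists_rigid hne hbd hop hconv hd hirr htf hdiv hγ hγ1 hγF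
  obtain ⟨i, hi⟩ := (hlim.eventually (gt_mem_nhds hδ)).exists
  obtain ⟨v', hv', hFv'⟩ := hFs i
  refine hFne i ?_
  rw [hFv'] at hi ⊢
  refine hv.eq_of_span_eq hv' hne hbd hop hconv (hrigid _ hv'.simplexFlat fun j => ?_)
  have hbdd : ∀ w : Fin d → Euc d, IsFlatWith Ω w →
      Bornology.IsBounded (closure (intrinsicInterior ℝ (convexHull ℝ (range w)))) :=
    fun w hw => (hbd.subset hw.2.2.1).closure
  obtain ⟨y, hy, hyv⟩ := exists_dist_lt_of_hausdorffDist_lt' (hv.vertex_mem_closure j) hi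
    (hausdorffEDist_ne_top_of_nonempty_of_bounded hv'.nonempty.closure hv.nonempty.closure
      (hbdd v' hv') (hbdd v hv))
  refine ⟨(y, 1), mk_one_mem_span (convexHull_subset_affineSpan _
    (IsFlatWith.closure_subset hy)), ?_⟩
  simpa [Prod.dist_eq] using hyv
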